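/- Let M be a smooth hypersurface of R^{n+1} with n ≥ 3 and b ∈ [0,1]. Then there exists C = C(n) > 0 such that for every φ ∈ C^1_c(M): (∫_M |φ|^{2(n−2b)/(n−2)} / |x|^{2b} dV)^{(n−2)/(n−2b)} ≤ C ∫_M (|∇_T φ|² + |Hφ|²) dV. -/

import Mathlib

open MeasureTheory
open scoped RealInnerProductSpace

noncomputable section

/-- Ambient Euclidean space `ℝ^{n+1}`. -/
abbrev Eu (n : ℕ) := EuclideanSpace ℝ (Fin (n + 1))

/-- A smooth `n`-dimensional hypersurface of `ℝ^{n+1}`, described by its carrier set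
together with a smooth unit normal field; locally it is a regular level set of a
smooth function. -/
structure Hypersurface (n : ℕ) where
  carrier : Set (Eu n)
  nu : Eu n → Eu n
  smooth_nu : ContDiff ℝ (⊤ : ℕ∞) nu
  unit_nu : ∀ x ∈ carrier, ‖nu x‖ = 1
  locally_level_set : ∀ x ∈ carrier, ∃ U : Set (Eu n), IsOpen U ∧ x ∈ U ∧
    ∃ f : Eu n → ℝ, ContDiff ℝ (⊤ : ℕ∞) f ∧
      carrier ∩ U = {y ∈ U | f y = 0} ∧
      (∀ y ∈ U, gradient f y ≠ 0) ∧
      (∀ y ∈ carrier ∩ U, nu y = ‖gradient f y‖⁻¹ • gradient f y)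

variable {n : ℕ}

/-- The `i`-th tangential derivative `δ_i φ = ∂_i φ − ν^i ∑_j (∂_j φ) ν^j`. -/
def tderiv (ν : Eu n → Eu n) (i : Fin (n + 1)) (φ : Eu n → ℝ) (x : Eu n) : ℝ :=
  fderiv ℝ φ x (EuclideanSpace.single i 1)
    - ν x i * ∑ j, fderiv ℝ φ x (EuclideanSpace.single j 1) * ν x j

/-- The tangential gradient `∇_T φ = ∇φ − (∇φ·ν)ν`. -/
def tgrad (ν : Eu n → Eu n) (φ : Eu n → ℝ) (x : Eu n) : Eu n :=
  gradient φ x - ⟪gradient φ x, ν x⟫ • ν x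

/-- The tangential divergence `div_T Z = ∑ i δ_i Z^i`. -/
def tdiv (ν : Eu n → Eu n) (Z : Eu n → Eu n) (x : Eu n) : ℝ :=
  ∑ i, tderiv ν i (fun y => Z y i) x

/-- The mean curvature `H = div_T ν` (sum of the principal curvatures). -/
def meanCurv (M : Hypersurface n) (x : Eu n) : ℝ := tdiv M.nu M.nu x

/-- The Laplace–Beltrami operator `Δφ = div_T (∇_T φ)`. -/
def lapBel (ν : Eu n → Eu n) (φ : Eu n → ℝ) (x : Eu n) : ℝ := tdiv ν (tgrad ν φ) x

/-- The surface measure on `M`: the `n`-dimensional Hausdorff measure restricted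
to the carrier of `M`. -/
def surfMeasure (M : Hypersurface n) : Measure (Eu n) :=
  (μH[(n : ℝ)]).restrict M.carrier

/-- `C^1` functions with compact support in a set `S`: ambient `C^1` functions
vanishing on `S` outside a compact subset `K ⊆ S`. -/
def C1cOn (S : Set (Eu n)) (φ : Eu n → ℝ) : Prop :=
  ContDiff ℝ 1 φ ∧ ∃ K : Set (Eu n), IsCompact K ∧ K ⊆ S ∧ ∀ x ∈ S, x ∉ K → φ x = 0

section Helpers
open Filter Topology Metric Set
open scoped NNReal ENNReal

open Filter Topology Metric Set
open scoped NNReal ENNReal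

/-- Parameter space `ℝ^n`. -/
abbrev Vn (n : ℕ) := EuclideanSpace ℝ (Fin n)

/-- An orthonormal splitting `E = ι V ⊕ ℝ e`. -/
structure Frame (n : ℕ) where
  inj : Vn n →L[ℝ] Eu n
  prj : Eu n →L[ℝ] Vn n
  e : Eu n
  adj : ∀ y x, ⟪inj y, x⟫ = ⟪y, prj x⟫
  prj_inj : ∀ y, prj (inj y) = y
  e_inj : ∀ y, ⟪e, inj y⟫ = 0
  norm_e : ‖e‖ = 1
  split : ∀ x, inj (prj x) + ⟪e, x⟫ • e = x

namespace Frame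

theorem exists_frame (e : Eu n) (he : ‖e‖ = 1) : ∃ T : Frame n, T.e = e := by
  have hne : e ≠ 0 := by rintro rfl; simp at he
  have : Fact (Module.finrank ℝ (Eu n) = n + 1) := ⟨by simp⟩
  have hd : Module.finrank ℝ ((ℝ ∙ e)ᗮ : Submodule ℝ (Eu n)) = n :=
    Submodule.finrank_orthogonal_span_singleton hne
  let b : OrthonormalBasis (Fin n) ℝ ((ℝ ∙ e)ᗮ : Submodule ℝ (Eu n)) :=
    (stdOrthonormalBasis ℝ _).reindex (finCongr hd)
  let S : Submodule ℝ (Eu n) := (ℝ ∙ e)ᗮ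
  let A : Vn n →L[ℝ] Eu n := S.subtypeL ∘L (b.repr.symm : Vn n →L[ℝ] S)
  let P : Eu n →L[ℝ] Vn n := (b.repr : S →L[ℝ] Vn n) ∘L S.orthogonalProjectionOnto
  refine ⟨⟨A, P, e, ?_, ?_, ?_, he, ?_⟩, rfl⟩
  · intro y x
    have h1 : ⟪A y, x⟫ = ⟪b.repr.symm y, S.orthogonalProjectionOnto x⟫ := by
      have h0 := Submodule.inner_orthogonalProjectionOnto_eq_of_mem_left (K := S) (b.repr.symm y) x
      rw [h0]; rfl
    rw [h1, ← b.repr.inner_map_map]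
    simp [P]
  · intro y
    simp [A, P]
  · intro y
    have : (A y) ∈ S := (b.repr.symm y).2
    exact (Submodule.mem_orthogonal_singleton_iff_inner_right).1 this
  · intro x
    have h1 : A (P x) = (S.orthogonalProjectionOnto x : Eu n) := by simp [A, P]
    rw [h1]
    have h2 := Submodule.starProjection_add_starProjection_orthogonal (K := ℝ ∙ e) x
    rw [Submodule.starProjection_unit_singleton ℝ he x] at h2
    rw [add_comm]
    exact h2

variable (T : Frame n)

theorem inner_inj (y z : Vn n) : ⟪T.inj y, T.inj z⟫ = ⟪y, z⟫ := by
  rw [T.adj, T.prj_inj]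

theorem norm_inj (y : Vn n) : ‖T.inj y‖ = ‖y‖ := by
  have := T.inner_inj y y
  rw [real_inner_self_eq_norm_sq, real_inner_self_eq_norm_sq] at this
  exact (sq_eq_sq₀ (norm_nonneg _) (norm_nonneg _)).1 this

theorem inner_e_e : ⟪T.e, T.e⟫ = 1 := by
  rw [real_inner_self_eq_norm_sq, T.norm_e]; norm_num

theorem inj_e (y : Vn n) : ⟪T.inj y, T.e⟫ = 0 := by
  rw [real_inner_comm]; exact T.e_inj y

theorem prj_e : T.prj T.e = 0 := by
  have h := T.adj (T.prj T.e) T.e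
  rw [T.inj_e] at h
  exact inner_self_eq_zero.1 h.symm

theorem norm_prj_le (x : Eu n) : ‖T.prj x‖ ≤ ‖x‖ := by
  have h := T.adj (T.prj x) x
  have h2 := real_inner_le_norm (T.inj (T.prj x)) x
  rw [h, real_inner_self_eq_norm_sq, T.norm_inj] at h2
  by_cases h0 : ‖T.prj x‖ = 0
  · rw [h0]; exact norm_nonneg _
  · have : 0 < ‖T.prj x‖ := lt_of_le_of_ne (norm_nonneg _) (Ne.symm h0)
    nlinarith

theorem norm_sq_add (y : Vn n) (t : ℝ) : ‖T.inj y + t • T.e‖ ^ 2 = ‖y‖ ^ 2 + t ^ 2 := by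
  rw [@norm_add_sq_real, inner_smul_right, T.inj_e, T.norm_inj, norm_smul, T.norm_e]
  simp

/-- graph map -/
def gr (g : Vn n → ℝ) (y : Vn n) : Eu n := T.inj y + g y • T.e

theorem prj_gr (g : Vn n → ℝ) (y : Vn n) : T.prj (T.gr g y) = y := by
  simp [gr, T.prj_inj, T.prj_e]

theorem e_gr (g : Vn n → ℝ) (y : Vn n) : ⟪T.e, T.gr g y⟫ = g y := by
  rw [gr, inner_add_right, T.e_inj, inner_smul_right, T.inner_e_e]; simp

theorem gr_prj {g : Vn n → ℝ} {x : Eu n} (h : ⟪T.e, x⟫ = g (T.prj x)) :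
    T.gr g (T.prj x) = x := by
  rw [gr, ← h]; exact T.split x

/-- the graph -/
def Gam (g : Vn n → ℝ) : Set (Eu n) := {x | ⟪T.e, x⟫ = g (T.prj x)}

theorem gr_mem (g : Vn n → ℝ) (y : Vn n) : T.gr g y ∈ T.Gam g := by
  simp only [Gam, mem_ofPred_eq, T.e_gr, T.prj_gr]

theorem gr_image (g : Vn n → ℝ) (A : Set (Vn n)) : T.prj ⁻¹' A ∩ T.Gam g = T.gr g '' A := by
  ext x
  constructor
  · rintro ⟨h1, h2⟩
    exact ⟨T.prj x, h1, T.gr_prj h2⟩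
  · rintro ⟨y, hy, rfl⟩
    exact ⟨by simpa [T.prj_gr] using hy, T.gr_mem g y⟩

theorem isClosed_Gam {g : Vn n → ℝ} (hg : Continuous g) : IsClosed (T.Gam g) :=
  isClosed_eq (by fun_prop) (hg.comp T.prj.continuous)

/-- derivative of the graph map -/
def dgr (a : Vn n →L[ℝ] ℝ) : Vn n →L[ℝ] Eu n := T.inj + a.smulRight T.e

theorem dgr_apply (a : Vn n →L[ℝ] ℝ) (v : Vn n) : T.dgr a v = T.inj v + a v • T.e := by
  simp [dgr]

theorem hasStrictFDerivAt_gr {g : Vn n → ℝ} {y : Vn n} {a : Vn n →L[ℝ] ℝ}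
    (h : HasStrictFDerivAt g a y) : HasStrictFDerivAt (T.gr g) (T.dgr a) y := by
  unfold gr dgr
  exact T.inj.hasStrictFDerivAt.add (h.smul_const T.e)

theorem norm_le_dgr (a : Vn n →L[ℝ] ℝ) (v : Vn n) : ‖v‖ ≤ ‖T.dgr a v‖ := by
  have := T.norm_sq_add v (a v)
  rw [← T.dgr_apply] at this
  exact abs_le_of_sq_le_sq' (by nlinarith [sq_nonneg (a v)]) (norm_nonneg _) |>.2

theorem normDet_dgr (p : Vn n) :
    ((T.dgr (innerSL ℝ p)) : Vn n →ₗ[ℝ] Eu n).normDet = Real.sqrt (1 + ‖p‖ ^ 2) := by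
  have h := ((T.dgr (innerSL ℝ p)) : Vn n →ₗ[ℝ] Eu n).normDet_sq_eq_det_gram
    (EuclideanSpace.basisFun (Fin n) ℝ)
  have h2 : Matrix.gram ℝ (fun i => ((T.dgr (innerSL ℝ p)) : Vn n →ₗ[ℝ] Eu n)
      (EuclideanSpace.basisFun (Fin n) ℝ i)) =
      1 + Matrix.replicateCol Unit (fun i => p i) * Matrix.replicateRow Unit (fun i => p i) := by
    ext i j
    simp only [Matrix.gram_apply, ContinuousLinearMap.coe_coe, T.dgr_apply, inner_add_left,
      inner_add_right, inner_smul_left, inner_smul_right, T.inj_e, T.e_inj, T.inner_e_e,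
      T.inner_inj, EuclideanSpace.basisFun_apply, innerSL_apply_apply, Matrix.add_apply,
      Matrix.mul_apply]
    simp [Matrix.one_apply, EuclideanSpace.inner_single_right, mul_comm]
    by_cases hij : i = j
    · simp [hij]
    · simp [hij, Ne.symm hij]
  rw [h2, Matrix.det_one_add_replicateCol_mul_replicateRow] at h
  have h3 : (fun i => p i) ⬝ᵥ (fun i => p i) = ‖p‖ ^ 2 := by
    rw [EuclideanSpace.norm_sq_eq]
    simp [dotProduct, sq]
  have h4 : ((T.dgr (innerSL ℝ p)) : Vn n →ₗ[ℝ] Eu n).normDet ^ 2 = 1 + ‖p‖ ^ 2 := by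
    rw [← h3]; exact_mod_cast h
  rw [← h4, Real.sqrt_sq (LinearMap.normDet_nonneg _)]

end Frame

theorem haus_le {X Y Z : Type*} [EMetricSpace Y] [MeasurableSpace Y] [BorelSpace Y]
    [EMetricSpace Z] [MeasurableSpace Z] [BorelSpace Z] [Nonempty X]
    (F : X → Y) (L : X → Z) (A : Set X) (C : ℝ≥0) {d : ℝ} (hd : 0 ≤ d)
    (h : ∀ x ∈ A, ∀ y ∈ A, edist (F x) (F y) ≤ C * edist (L x) (L y)) :
    μH[d] (F '' A) ≤ (C : ℝ≥0∞) ^ d * μH[d] (L '' A) := by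
  classical
  let G : Z → Y := fun z => F (Function.invFunOn L A z)
  have hG : LipschitzOnWith C G (L '' A) := by
    intro z hz w hw
    have h1 := Function.invFunOn_mem hz
    have h2 := Function.invFunOn_mem hw
    have h3 := Function.invFunOn_eq hz
    have h4 := Function.invFunOn_eq hw
    have := h _ h1 _ h2
    rwa [h3, h4] at this
  have hsub : F '' A ⊆ G '' (L '' A) := by
    rintro _ ⟨x, hx, rfl⟩
    refine ⟨L x, ⟨x, hx, rfl⟩, ?_⟩
    have hz : L x ∈ L '' A := ⟨x, hx, rfl⟩
    have h1 := Function.invFunOn_mem hz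
    have h3 := Function.invFunOn_eq hz
    have := h _ h1 _ hx
    rw [h3] at this
    simp only [edist_self, mul_zero, nonpos_iff_eq_zero, edist_eq_zero] at this
    exact this
  exact (measure_mono hsub).trans (hG.hausdorffMeasure_image_le hd)

namespace Frame
variable (T : Frame n)

/-- area density -/
def Wd (g : Vn n → ℝ) (y : Vn n) : ℝ := Real.sqrt (1 + ‖gradient g y‖ ^ 2)

/-- projected surface measure -/
def lam (g : Vn n → ℝ) : Measure (Vn n) :=
  ((μH[(n : ℝ)] : Measure (Eu n)).restrict (T.Gam g)).map T.prj

theorem lam_apply (g : Vn n → ℝ) {A : Set (Vn n)} (hA : MeasurableSet A) :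
    T.lam g A = μH[(n : ℝ)] (T.gr g '' A) := by
  rw [lam, Measure.map_apply T.prj.continuous.measurable hA,
    Measure.restrict_apply (T.prj.continuous.measurable hA), T.gr_image]

theorem edist_gr_le {g : Vn n → ℝ} {K : ℝ≥0} (hg : LipschitzWith K g) :
    LipschitzWith (1 + K) (T.gr g) := by
  apply LipschitzWith.of_dist_le_mul
  intro x y
  have h1 : T.gr g x - T.gr g y = T.inj (x - y) + (g x - g y) • T.e := by
    simp only [gr, map_sub, sub_smul]; abel
  rw [dist_eq_norm, h1]
  refine (norm_add_le _ _).trans ?_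
  rw [T.norm_inj, norm_smul, T.norm_e, ← dist_eq_norm, ← dist_eq_norm]
  have := hg.dist_le_mul x y
  push_cast
  nlinarith

theorem lam_le {g : Vn n → ℝ} {K : ℝ≥0} (hg : LipschitzWith K g) {A : Set (Vn n)}
    (hA : MeasurableSet A) :
    T.lam g A ≤ ((1 + K : ℝ≥0) : ℝ≥0∞) ^ (n : ℝ) * μH[(n : ℝ)] A := by
  rw [T.lam_apply g hA]
  exact (T.edist_gr_le hg).hausdorffMeasure_image_le (by positivity) A

theorem haus_dgr (p : Vn n) (A : Set (Vn n)) :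
    μH[(n : ℝ)] (T.dgr (innerSL ℝ p) '' A) =
      ENNReal.ofReal (Real.sqrt (1 + ‖p‖ ^ 2)) * μH[(n : ℝ)] A := by
  have h := LinearMap.hausdorffMeasure_image ((T.dgr (innerSL ℝ p)) : Vn n →ₗ[ℝ] Eu n) A
  rw [T.normDet_dgr] at h
  simpa using h

theorem lam_ratio {g : Vn n → ℝ} (hg : ContDiff ℝ 1 g) (y : Vn n) {ε : ℝ} (h0 : 0 < ε)
    (h1 : ε < 1) : ∀ᶠ r in 𝓝[>] (0 : ℝ),
      T.lam g (closedBall y r) ≤ ENNReal.ofReal (1 + ε) ^ (n : ℝ) *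
          (ENNReal.ofReal (Wd g y) * μH[(n : ℝ)] (closedBall y r)) ∧
      ENNReal.ofReal (Wd g y) * μH[(n : ℝ)] (closedBall y r) ≤
        ENNReal.ofReal ((1 - ε)⁻¹) ^ (n : ℝ) * T.lam g (closedBall y r) := by
  have hd : HasStrictFDerivAt g (innerSL ℝ (gradient g y)) y := by
    have := hg.contDiffAt (x := y) |>.hasStrictFDerivAt (by norm_num)
    convert! this using 1
    ext v
    simp [gradient]
  have hF := T.hasStrictFDerivAt_gr hd
  have hlo := hF.isLittleO
  rw [Asymptotics.isLittleO_iff] at hlo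
  have hlo := hlo h0
  rw [nhds_prod_eq] at hlo
  obtain ⟨t, ht, hlo⟩ := Filter.eventually_prod_self_iff'.1 hlo
  obtain ⟨r0, hr0, hrt⟩ := Metric.nhds_basis_closedBall.mem_iff.1 ht
  filter_upwards [Ioc_mem_nhdsGT hr0] with r hr
  have hsub : closedBall y r ⊆ t := (closedBall_subset_closedBall hr.2).trans hrt
  rw [T.lam_apply g isClosed_closedBall.measurableSet, Wd, ← T.haus_dgr]
  set L := T.dgr (innerSL ℝ (gradient g y)) with hL
  have key : ∀ a ∈ closedBall y r, ∀ b ∈ closedBall y r,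
      ‖T.gr g a - T.gr g b - L (a - b)‖ ≤ ε * ‖L (a - b)‖ := by
    intro a ha b hb
    refine (hlo a (hsub ha) b (hsub hb) : _).trans ?_
    gcongr
    exact T.norm_le_dgr _ _
  constructor
  · apply haus_le _ _ _ _ (by positivity)
    intro a ha b hb
    have h := key a ha b hb
    have h2 : ‖T.gr g a - T.gr g b‖ ≤ (1 + ε) * ‖L a - L b‖ := by
      have := norm_le_norm_add_norm_sub (L (a - b)) (T.gr g a - T.gr g b)
      rw [norm_sub_rev] at h
      rw [← map_sub]; linarith
    rw [edist_dist, edist_dist, dist_eq_norm, dist_eq_norm]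
    change _ ≤ ENNReal.ofReal (1 + ε) * _
    rw [← ENNReal.ofReal_mul (by linarith)]
    exact ENNReal.ofReal_le_ofReal h2
  · apply haus_le _ _ _ _ (by positivity)
    intro a ha b hb
    have h := key a ha b hb
    have h2 : ‖L a - L b‖ ≤ (1 - ε)⁻¹ * ‖T.gr g a - T.gr g b‖ := by
      have := norm_le_norm_add_norm_sub (T.gr g a - T.gr g b) (L (a - b))
      rw [← map_sub]
      rw [inv_mul_eq_div, le_div_iff₀ (by linarith)]; linarith
    rw [edist_dist, edist_dist, dist_eq_norm, dist_eq_norm]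
    change _ ≤ ENNReal.ofReal ((1 - ε)⁻¹) * _
    rw [← ENNReal.ofReal_mul (by rw [inv_nonneg]; linarith)]
    exact ENNReal.ofReal_le_ofReal h2

theorem lam_eq {g : Vn n → ℝ} (hg : ContDiff ℝ 1 g) {K : ℝ≥0} (hK : LipschitzWith K g) :
    T.lam g = (μH[(n : ℝ)] : Measure (Vn n)).withDensity (fun y => ENNReal.ofReal (Wd g y)) := by
  set m : Measure (Vn n) := μH[(n : ℝ)] with hm
  have hlf : IsLocallyFiniteMeasure (T.lam g) := by
    refine ⟨fun x => ⟨closedBall x 1, closedBall_mem_nhds x one_pos, ?_⟩⟩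
    refine (T.lam_le hK isClosed_closedBall.measurableSet).trans_lt ?_
    exact ENNReal.mul_lt_top (ENNReal.rpow_lt_top_of_nonneg (by positivity) ENNReal.coe_ne_top)
      (isCompact_closedBall x 1).measure_lt_top
  have hac : T.lam g ≪ m := by
    refine Measure.AbsolutelyContinuous.mk fun s hs h0 => ?_
    have := T.lam_le hK hs
    rw [← hm, h0, mul_zero] at this
    exact nonpos_iff_eq_zero.1 this
  rw [← Measure.withDensity_rnDeriv_eq _ _ hac]
  apply withDensity_congr_ae
  filter_upwards [Besicovitch.ae_tendsto_rnDeriv (T.lam g) m] with y hy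
  set d := (T.lam g).rnDeriv m y
  have hpos : ∀ r > 0, m (closedBall y r) ≠ 0 := fun r hr =>
    (measure_closedBall_pos m y hr).ne'
  have hfin : ∀ r, m (closedBall y r) ≠ ∞ := fun r => measure_closedBall_lt_top.ne
  have hup : ∀ ε : ℝ, 0 < ε → ε < 1 →
      d ≤ ENNReal.ofReal (1 + ε) ^ (n : ℝ) * ENNReal.ofReal (Wd g y) := by
    intro ε h0 h1
    refine le_of_tendsto hy ?_
    filter_upwards [T.lam_ratio hg y h0 h1, self_mem_nhdsWithin] with r hr hr0
    apply ENNReal.div_le_of_le_mul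
    rw [mul_assoc]; exact hr.1
  have hlow : ∀ ε : ℝ, 0 < ε → ε < 1 →
      ENNReal.ofReal (Wd g y) ≤ ENNReal.ofReal ((1 - ε)⁻¹) ^ (n : ℝ) * d := by
    intro ε h0 h1
    have ht := ENNReal.Tendsto.const_mul (a := ENNReal.ofReal ((1 - ε)⁻¹) ^ (n : ℝ)) hy
      (Or.inr (ENNReal.rpow_lt_top_of_nonneg (by positivity) ENNReal.ofReal_ne_top).ne)
    refine ge_of_tendsto ht ?_
    filter_upwards [T.lam_ratio hg y h0 h1, self_mem_nhdsWithin] with r hr hr0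
    rw [← mul_div_assoc, ENNReal.le_div_iff_mul_le (Or.inl (hpos r hr0)) (Or.inl (hfin r))]
    exact hr.2
  have hI : Ioo (0 : ℝ) 1 ∈ 𝓝[>] (0 : ℝ) := Ioo_mem_nhdsGT one_pos
  have hd : d ≠ ∞ := by
    refine ((hup (1/2) (by norm_num) (by norm_num)).trans_lt ?_).ne
    exact ENNReal.mul_lt_top
      (ENNReal.rpow_lt_top_of_nonneg (by positivity) ENNReal.ofReal_ne_top) ENNReal.ofReal_lt_top
  apply le_antisymm
  · have : Tendsto (fun ε : ℝ => ENNReal.ofReal (1 + ε) ^ (n : ℝ) * ENNReal.ofReal (Wd g y))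
        (𝓝[>] 0) (𝓝 (ENNReal.ofReal (1 + 0) ^ (n : ℝ) * ENNReal.ofReal (Wd g y))) := by
      apply ENNReal.Tendsto.mul_const _ (Or.inr ENNReal.ofReal_ne_top)
      apply Tendsto.mono_left _ nhdsWithin_le_nhds
      have : Continuous (fun ε : ℝ => ENNReal.ofReal (1 + ε) ^ (n : ℝ)) := by
        exact ENNReal.continuous_rpow_const.comp (ENNReal.continuous_ofReal.comp (by fun_prop))
      exact this.tendsto 0
    simp only [add_zero, ENNReal.ofReal_one, ENNReal.one_rpow, one_mul] at this
    refine ge_of_tendsto this ?_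
    filter_upwards [hI] with ε hε using hup ε hε.1 hε.2
  · have : Tendsto (fun ε : ℝ => ENNReal.ofReal ((1 - ε)⁻¹) ^ (n : ℝ) * d)
        (𝓝[>] 0) (𝓝 (ENNReal.ofReal ((1 - 0)⁻¹) ^ (n : ℝ) * d)) := by
      apply ENNReal.Tendsto.mul_const _ (Or.inr hd)
      apply Tendsto.mono_left _ nhdsWithin_le_nhds
      have : ContinuousAt (fun ε : ℝ => (1 - ε)⁻¹) 0 := by
        apply ContinuousAt.inv₀ (by fun_prop) (by norm_num)
      exact (ENNReal.continuous_rpow_const.comp ENNReal.continuous_ofReal).continuousAt.comp this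
    simp only [sub_zero, inv_one, ENNReal.ofReal_one, ENNReal.one_rpow, one_mul] at this
    refine ge_of_tendsto this ?_
    filter_upwards [hI] with ε hε using hlow ε hε.1 hε.2

theorem continuous_gradient' {E : Type*} [NormedAddCommGroup E] [InnerProductSpace ℝ E]
    [CompleteSpace E] {g : E → ℝ} (hg : ContDiff ℝ 1 g) : Continuous (gradient g) := by
  unfold gradient
  exact (InnerProductSpace.toDual ℝ E).symm.continuous.comp (hg.continuous_fderiv (by norm_num))

/-- area formula for integrals over graphs -/
theorem integral_Gam {g : Vn n → ℝ} (hg : ContDiff ℝ 1 g) {K : ℝ≥0} (hK : LipschitzWith K g)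
    {G : Eu n → ℝ} (hG : Continuous G) :
    ∫ x in T.Gam g, G x ∂μH[(n : ℝ)] = ∫ y, Wd g y * G (T.gr g y) ∂μH[(n : ℝ)] := by
  have hgr : Continuous (T.gr g) := by
    unfold gr; have := hg.continuous; fun_prop
  have h1 : ∫ x in T.Gam g, G x ∂μH[(n : ℝ)] =
      ∫ x in T.Gam g, G (T.gr g (T.prj x)) ∂μH[(n : ℝ)] := by
    apply setIntegral_congr_fun (T.isClosed_Gam hg.continuous).measurableSet
    intro x hx
    have : ⟪T.e, x⟫ = g (T.prj x) := hx
    simp only [T.gr_prj this]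
  rw [h1]
  have h2 := integral_map (μ := (μH[(n : ℝ)] : Measure (Eu n)).restrict (T.Gam g))
    (φ := T.prj) (f := fun y => G (T.gr g y)) T.prj.continuous.aemeasurable
    (hG.comp hgr).aestronglyMeasurable
  rw [← h2]
  change ∫ y, G (T.gr g y) ∂(T.lam g) = _
  rw [T.lam_eq hg hK, integral_withDensity_eq_integral_toReal_smul]
  · apply integral_congr_ae
    filter_upwards with y
    rw [ENNReal.toReal_ofReal (by unfold Wd; exact Real.sqrt_nonneg _)]; rfl
  · have := continuous_gradient' hg
    exact ENNReal.measurable_ofReal.comp (by unfold Wd; fun_prop)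
  · filter_upwards with y using ENNReal.ofReal_lt_top
end Frame


theorem sum_single_apply (L : Eu n →L[ℝ] ℝ) (v : Eu n) :
    ∑ j, L (EuclideanSpace.single j 1) * v j = L v := by
  have h : v = ∑ j, v j • (EuclideanSpace.single j (1 : ℝ) : Eu n) := by
    have := (EuclideanSpace.basisFun (Fin (n + 1)) ℝ).sum_repr v
    simpa using this.symm
  conv_rhs => rw [h]
  rw [map_sum]
  apply Finset.sum_congr rfl
  intro j _
  rw [map_smul, smul_eq_mul, mul_comm]

theorem tdiv_eq {ν X : Eu n → Eu n} {x : Eu n} {L : Eu n →L[ℝ] Eu n} (hX : HasFDerivAt X L x) :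
    tdiv ν X x = LinearMap.trace ℝ _ (L : Eu n →ₗ[ℝ] Eu n) - ⟪ν x, L (ν x)⟫ := by
  have hi : ∀ i : Fin (n + 1), fderiv ℝ (fun y => X y i) x = (EuclideanSpace.proj i : Eu n →L[ℝ] ℝ) ∘L L := by
    intro i
    exact ((EuclideanSpace.proj i : Eu n →L[ℝ] ℝ).hasFDerivAt.comp x hX).fderiv
  unfold tdiv tderiv
  simp only [sum_single_apply]
  rw [Finset.sum_sub_distrib, LinearMap.trace_eq_sum_inner _ (EuclideanSpace.basisFun (Fin (n + 1)) ℝ)]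
  congr 1
  · apply Finset.sum_congr rfl
    intro i _
    rw [hi]
    simp [EuclideanSpace.inner_single_left]
  · rw [PiLp.inner_apply]
    apply Finset.sum_congr rfl
    intro i _
    rw [hi]
    simp [mul_comm]

theorem trace_rank_one {ν : Eu n} (hν : ‖ν‖ = 1) {L : Eu n →L[ℝ] Eu n}
    (h : ∀ v, ⟪ν, v⟫ = 0 → L v = 0) :
    LinearMap.trace ℝ _ (L : Eu n →ₗ[ℝ] Eu n) = ⟪ν, L ν⟫ := by
  have h1 : ∀ v, L v = ⟪ν, v⟫ • L ν := by
    intro v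
    have := h (v - ⟪ν, v⟫ • ν) (by
      rw [inner_sub_right, inner_smul_right, real_inner_self_eq_norm_sq, hν]; ring)
    rw [map_sub, map_smul, sub_eq_zero] at this
    exact this
  rw [LinearMap.trace_eq_sum_inner _ (EuclideanSpace.basisFun (Fin (n + 1)) ℝ),
    ← OrthonormalBasis.sum_inner_mul_inner (EuclideanSpace.basisFun (Fin (n + 1)) ℝ) ν (L ν)]
  apply Finset.sum_congr rfl
  intro i _
  rw [ContinuousLinearMap.coe_coe, h1, inner_smul_right]

theorem tdiv_congr_fderiv {ν ν' X Y : Eu n → Eu n} {x : Eu n} (hν : ‖ν x‖ = 1)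
    (hνν : ν' x = ν x)
    (hX : DifferentiableAt ℝ X x) (hY : DifferentiableAt ℝ Y x)
    (h : ∀ v, ⟪ν x, v⟫ = 0 → fderiv ℝ X x v = fderiv ℝ Y x v) :
    tdiv ν X x = tdiv ν' Y x := by
  rw [tdiv_eq hX.hasFDerivAt, tdiv_eq hY.hasFDerivAt, hνν]
  have := trace_rank_one hν (L := fderiv ℝ X x - fderiv ℝ Y x) (by
    intro v hv; simp [h v hv])
  simp only [ContinuousLinearMap.toLinearMap_sub, map_sub, ContinuousLinearMap.sub_apply,
    inner_sub_right] at this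
  linarith

theorem inner_tgrad {ν : Eu n → Eu n} {φ : Eu n → ℝ} {x : Eu n} (v : Eu n) :
    ⟪tgrad ν φ x, v⟫ = fderiv ℝ φ x v - fderiv ℝ φ x (ν x) * ⟪ν x, v⟫ := by
  unfold tgrad
  rw [inner_sub_left, inner_smul_left]
  simp [gradient]

theorem tgrad_congr_fderiv {ν : Eu n → Eu n} {φ ψ : Eu n → ℝ} {x : Eu n} (hν : ‖ν x‖ = 1)
    (h : ∀ v, ⟪ν x, v⟫ = 0 → fderiv ℝ φ x v = fderiv ℝ ψ x v) :
    tgrad ν φ x = tgrad ν ψ x := by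
  apply ext_inner_right ℝ
  intro v
  rw [inner_tgrad, inner_tgrad]
  have := h (v - ⟪ν x, v⟫ • ν x) (by
      rw [inner_sub_right, inner_smul_right, real_inner_self_eq_norm_sq, hν]; ring)
  simp only [map_sub, map_smul, smul_eq_mul] at this
  linarith

theorem tdiv_smul {ν Y : Eu n → Eu n} {u : Eu n → ℝ} {x : Eu n}
    (hu : DifferentiableAt ℝ u x) (hY : DifferentiableAt ℝ Y x) :
    tdiv ν (fun y => u y • Y y) x = u x * tdiv ν Y x + ⟪tgrad ν u x, Y x⟫ := by
  have h := hu.hasFDerivAt.smul hY.hasFDerivAt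
  rw [tdiv_eq (X := fun y => u y • Y y) h, tdiv_eq hY.hasFDerivAt, inner_tgrad]
  have ht : LinearMap.trace ℝ (Eu n) (((fderiv ℝ u x).smulRight (Y x) : Eu n →L[ℝ] Eu n) : Eu n →ₗ[ℝ] Eu n)
      = fderiv ℝ u x (Y x) := by
    have := LinearMap.trace_smulRight (R := ℝ) ((fderiv ℝ u x) : Eu n →ₗ[ℝ] ℝ) (Y x)
    exact this
  simp only [ContinuousLinearMap.toLinearMap_add, ContinuousLinearMap.toLinearMap_smul, map_add, map_smul, ht,
    smul_eq_mul, ContinuousLinearMap.add_apply, ContinuousLinearMap.smul_apply, inner_add_right,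
    inner_smul_right, ContinuousLinearMap.smulRight_apply]
  rw [real_inner_comm (Y x) (ν x)]
  ring_nf
  try rw [real_inner_comm (Y x) (ν x)]

/-- integral of a divergence -/
theorem integral_trace_fderiv {Q : Vn n → Vn n} (hQ : ContDiff ℝ 1 Q) (hc : HasCompactSupport Q) :
    ∫ y, LinearMap.trace ℝ _ (fderiv ℝ Q y : Vn n →ₗ[ℝ] Vn n) ∂μH[(n : ℝ)] = 0 := by
  simp only [LinearMap.trace_eq_sum_inner _ (EuclideanSpace.basisFun (Fin n) ℝ)]
  have hcont : Continuous (fderiv ℝ Q) := hQ.continuous_fderiv (by norm_num)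
  have hcs : HasCompactSupport (fderiv ℝ Q) := hc.fderiv ℝ
  have hint : ∀ i, Integrable (fun y => ⟪EuclideanSpace.basisFun (Fin n) ℝ i,
      (fderiv ℝ Q y) (EuclideanSpace.basisFun (Fin n) ℝ i)⟫) (μH[(n : ℝ)] : Measure (Vn n)) := by
    intro i
    apply Continuous.integrable_of_hasCompactSupport
    · fun_prop
    · exact hcs.comp_left (g := fun L : Vn n →L[ℝ] Vn n => ⟪EuclideanSpace.basisFun (Fin n) ℝ i,
        L (EuclideanSpace.basisFun (Fin n) ℝ i)⟫) (by simp)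
  simp only [ContinuousLinearMap.coe_coe]
  rw [integral_finsetSum _ (fun i _ => hint i)]
  apply Finset.sum_eq_zero
  intro i _
  have hb := hint i
  generalize EuclideanSpace.basisFun (Fin n) ℝ i = b at hb ⊢
  have hq : ContDiff ℝ 1 (fun y => ⟪b, Q y⟫) := contDiff_const.inner ℝ hQ
  have hfd : ∀ y, fderiv ℝ (fun y => ⟪b, Q y⟫) y b = ⟪b, fderiv ℝ Q y b⟫ := by
    intro y
    have := ((innerSL ℝ b).hasFDerivAt.comp y (hQ.differentiable (by norm_num) y).hasFDerivAt).fderiv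
    exact congrArg (fun L => L b) this
  have h := integral_mul_fderiv_eq_neg_fderiv_mul_of_integrable (μ := (μH[(n : ℝ)] : Measure (Vn n)))
    (f := fun _ => (1 : ℝ)) (g := fun y => ⟪b, Q y⟫) (v := b) (by simp)
    (by simpa only [hfd, one_mul] using hb)
    (by
      simp only [one_mul]
      apply Continuous.integrable_of_hasCompactSupport hq.continuous
      exact hc.comp_left (g := fun z : Vn n => ⟪b, z⟫) (by simp))
    (fun x _ => by fun_prop) (fun x _ => hq.differentiable (by norm_num) x)
  simpa [hfd] using h

namespace Frame
variable (T : Frame n)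

/-- unit normal to the graph -/
def nrm (g : Vn n → ℝ) (y : Vn n) : Eu n := (Wd g y)⁻¹ • (T.e - T.inj (gradient g y))

/-- unit normal extended to the cylinder -/
def nrmP (g : Vn n → ℝ) (x : Eu n) : Eu n := T.nrm g (T.prj x)

theorem Wd_pos (g : Vn n → ℝ) (y : Vn n) : 0 < Wd g y := Real.sqrt_pos.2 (by positivity)

theorem Wd_sq (g : Vn n → ℝ) (y : Vn n) : Wd g y ^ 2 = 1 + ‖gradient g y‖ ^ 2 :=
  Real.sq_sqrt (by positivity)

theorem norm_sub_inj (p : Vn n) : ‖T.e - T.inj p‖ ^ 2 = 1 + ‖p‖ ^ 2 := by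
  have h := T.norm_sq_add (-p) 1
  rw [map_neg, one_smul, norm_neg] at h
  rw [← neg_add_eq_sub, h]; ring

theorem norm_nrm (g : Vn n → ℝ) (y : Vn n) : ‖T.nrm g y‖ = 1 := by
  have h := T.norm_sub_inj (gradient g y)
  rw [← Wd_sq] at h
  have h2 := (sq_eq_sq₀ (norm_nonneg _) (Wd_pos g y).le).1 h
  rw [nrm, norm_smul, h2, norm_inv, Real.norm_of_nonneg (Wd_pos g y).le,
    inv_mul_cancel₀ (Wd_pos g y).ne']

theorem prj_nrm (g : Vn n → ℝ) (y : Vn n) : T.prj (T.nrm g y) = -((Wd g y)⁻¹ • gradient g y) := by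
  rw [nrm, map_smul, map_sub, T.prj_e, T.prj_inj]; simp

theorem fderiv_eq_inner (g : Vn n → ℝ) (y v : Vn n) : fderiv ℝ g y v = ⟪gradient g y, v⟫ := by
  simp [gradient]

theorem tangent_eq {g : Vn n → ℝ} {y : Vn n} {v : Eu n} (hv : ⟪T.nrm g y, v⟫ = 0) :
    T.dgr (fderiv ℝ g y) (T.prj v) = v := by
  rw [dgr_apply, fderiv_eq_inner, ← T.adj]
  rw [nrm, inner_smul_left, inner_sub_left] at hv
  have h := (mul_eq_zero.1 hv).resolve_left (by simpa using (Wd_pos g y).ne')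
  have h2 : ⟪T.inj (gradient g y), v⟫ = ⟪T.e, v⟫ := by linarith
  rw [h2]; exact T.split v

theorem contDiff_gradient {E : Type*} [NormedAddCommGroup E] [InnerProductSpace ℝ E]
    [CompleteSpace E] {g : E → ℝ} {k l : WithTop ℕ∞} (hg : ContDiff ℝ k g) (h : l + 1 ≤ k) :
    ContDiff ℝ l (gradient g) := by
  unfold gradient
  exact (InnerProductSpace.toDual ℝ E).symm.contDiff.comp (hg.fderiv_right h)

theorem contDiff_Wd {g : Vn n → ℝ} (hg : ContDiff ℝ 2 g) : ContDiff ℝ 1 (Wd g) := by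
  unfold Wd
  have := contDiff_gradient (l := 1) hg (by norm_num)
  apply ContDiff.sqrt (contDiff_const.add (this.norm_sq ℝ))
  intro y; positivity

theorem contDiff_nrm {g : Vn n → ℝ} (hg : ContDiff ℝ 2 g) : ContDiff ℝ 1 (T.nrm g) := by
  unfold nrm
  have := contDiff_gradient (l := 1) hg (by norm_num)
  exact ((contDiff_Wd hg).inv (fun y => (Wd_pos g y).ne')).smul
    (contDiff_const.sub (T.inj.contDiff.comp this))

theorem contDiff_nrmP {g : Vn n → ℝ} (hg : ContDiff ℝ 2 g) : ContDiff ℝ 1 (T.nrmP g) :=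
  (T.contDiff_nrm hg).comp T.prj.contDiff

theorem gradient_symm {g : Vn n → ℝ} (hg : ContDiff ℝ 2 g) (y v w : Vn n) :
    ⟪fderiv ℝ (gradient g) y v, w⟫ = ⟪v, fderiv ℝ (gradient g) y w⟫ := by
  have hs : IsSymmSndFDerivAt ℝ g y := hg.contDiffAt.isSymmSndFDerivAt (by simp)
  have hd : DifferentiableAt ℝ (fderiv ℝ g) y :=
    (hg.fderiv_right (m := 1) (by norm_num)).differentiable (by norm_num) y
  have hG : HasFDerivAt (gradient g) (fderiv ℝ (gradient g) y) y :=
    ((contDiff_gradient (l := 1) hg (by norm_num)).differentiable (by norm_num) y).hasFDerivAt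
  have h2 : ∀ v w, ⟪fderiv ℝ (gradient g) y v, w⟫ = fderiv ℝ (fderiv ℝ g) y v w := by
    intro v w
    have e1 : HasFDerivAt (fun z => ⟪w, gradient g z⟫) _ y := (innerSL ℝ w).hasFDerivAt.comp y hG
    have e2 : HasFDerivAt (fun z => fderiv ℝ g z w) _ y :=
      (ContinuousLinearMap.apply ℝ ℝ w).hasFDerivAt.comp y hd.hasFDerivAt
    have e3 : (fun z => ⟪w, gradient g z⟫) = fun z => fderiv ℝ g z w := by
      funext z; rw [fderiv_eq_inner, real_inner_comm]
    rw [e3] at e1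
    have := congrArg (fun L => L v) (e1.unique e2)
    rw [real_inner_comm]
    exact this
  rw [h2, real_inner_comm, h2]
  exact hs v w

theorem trace_smulRight' {E : Type*} [NormedAddCommGroup E] [InnerProductSpace ℝ E]
    [FiniteDimensional ℝ E] (a : E →L[ℝ] ℝ) (w : E) :
    LinearMap.trace ℝ E ((a.smulRight w : E →L[ℝ] E) : E →ₗ[ℝ] E) = a w :=
  LinearMap.trace_smulRight (R := ℝ) (a : E →ₗ[ℝ] ℝ) w

theorem div_point {g : Vn n → ℝ} (hg : ContDiff ℝ 2 g) {Z : Vn n → Eu n} (hZ : ContDiff ℝ 1 Z)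
    (y : Vn n) :
    LinearMap.trace ℝ _ (fderiv ℝ (fun y => Wd g y • T.prj (Z y) +
        ⟪Z y, T.nrm g y⟫ • gradient g y) y : Vn n →ₗ[ℝ] Vn n) =
      Wd g y * (tdiv (T.nrmP g) (Z ∘ T.prj) (T.gr g y) -
        tdiv (T.nrmP g) (T.nrmP g) (T.gr g y) * ⟪Z y, T.nrm g y⟫) := by
  have hGc := contDiff_gradient (l := 1) hg (by norm_num)
  have hG : HasFDerivAt (gradient g) (fderiv ℝ (gradient g) y) y :=
    (hGc.differentiable (by norm_num) y).hasFDerivAt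
  have hsym := gradient_symm hg y
  have hA : HasFDerivAt Z (fderiv ℝ Z y) y := (hZ.differentiable (by norm_num) y).hasFDerivAt
  have hW : HasFDerivAt (Wd g) (fderiv ℝ (Wd g) y) y :=
    ((contDiff_Wd hg).differentiable (by norm_num) y).hasFDerivAt
  have hpos := Wd_pos g y
  have hDW : ∀ v, fderiv ℝ (Wd g) y v = (Wd g y)⁻¹ * ⟪gradient g y, fderiv ℝ (gradient g) y v⟫ := by
    intro v
    have e1 : HasFDerivAt (fun y => Wd g y * Wd g y) _ y := hW.mul hW
    have e2 : HasFDerivAt (fun y => 1 + ⟪gradient g y, gradient g y⟫) _ y :=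
      (hG.inner ℝ hG).const_add 1
    have e3 : (fun y => Wd g y * Wd g y) = fun y => 1 + ⟪gradient g y, gradient g y⟫ := by
      funext z; rw [← sq, Wd_sq, real_inner_self_eq_norm_sq]
    rw [e3] at e1
    have e4 := congrArg (fun L => L v) (e1.unique e2)
    simp [fderivInnerCLM_apply] at e4
    rw [← fderiv_eq_inner g]
    field_simp
    linarith
  generalize fderiv ℝ (Wd g) y = DW at *
  generalize fderiv ℝ Z y = A at *
  have hN : HasFDerivAt (T.nrm g) ((Wd g y)⁻¹ • (-(T.inj ∘L fderiv ℝ (gradient g) y)) +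
      (-((Wd g y ^ 2)⁻¹ • DW)).smulRight (T.e - T.inj (gradient g y))) y := by
    have i1 : HasFDerivAt (fun y => (Wd g y)⁻¹) (-((Wd g y ^ 2)⁻¹ • DW)) y := by
      have := (hasDerivAt_inv hpos.ne').comp_hasFDerivAt y hW
      convert! this using 1
      simp
    have i2 : HasFDerivAt (fun y => T.e - T.inj (gradient g y))
        (-(T.inj ∘L fderiv ℝ (gradient g) y)) y := by
      exact (T.inj.hasFDerivAt.comp y hG).const_sub T.e
    exact i1.smul i2
  generalize hB : ((Wd g y)⁻¹ • (-(T.inj ∘L fderiv ℝ (gradient g) y)) +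
      (-((Wd g y ^ 2)⁻¹ • DW)).smulRight (T.e - T.inj (gradient g y))) = B at *
  have hBv : ∀ v, B v = -((Wd g y)⁻¹ • T.inj (fderiv ℝ (gradient g) y v)) -
      ((Wd g y)⁻¹ * DW v) • T.nrm g y := by
    intro v
    rw [← hB, nrm, smul_smul]
    have : ((Wd g y)⁻¹ * DW v * (Wd g y)⁻¹) = (Wd g y ^ 2)⁻¹ * DW v := by
      field_simp
    rw [this]
    simp [sub_eq_add_neg]
    abel
  have hNB : ∀ v, ⟪T.nrm g y, B v⟫ = 0 := by
    intro v
    have e1 : HasFDerivAt (fun y => ⟪T.nrm g y, T.nrm g y⟫) _ y := hN.inner ℝ hN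
    have e3 : (fun y => ⟪T.nrm g y, T.nrm g y⟫) = fun _ => (1 : ℝ) := by
      funext z; rw [real_inner_self_eq_norm_sq, T.norm_nrm]; norm_num
    rw [e3] at e1
    have e4 := congrArg (fun L => L v) (e1.unique (hasFDerivAt_const _ _))
    simp [fderivInnerCLM_apply] at e4
    rw [real_inner_comm (T.nrm g y) (B v)] at e4
    linarith
  have tg := T.prj_gr g y
  have hp : HasFDerivAt T.prj T.prj (T.gr g y) := T.prj.hasFDerivAt
  have hZp : HasFDerivAt (Z ∘ T.prj) (A ∘L T.prj) (T.gr g y) := by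
    apply HasFDerivAt.comp _ _ hp; rw [tg]; exact hA
  have hNp : HasFDerivAt (T.nrmP g) (B ∘L T.prj) (T.gr g y) := by
    have : HasFDerivAt (T.nrm g ∘ T.prj) (B ∘L T.prj) (T.gr g y) := by
      apply HasFDerivAt.comp _ _ hp; rw [tg]; exact hN
    exact this
  have hQ : HasFDerivAt (fun y => Wd g y • T.prj (Z y) + ⟪Z y, T.nrm g y⟫ • gradient g y)
      _ y := (hW.smul (T.prj.hasFDerivAt.comp y hA)).add ((hA.inner ℝ hN).smul hG)
  have hnP : T.nrmP g (T.gr g y) = T.nrm g y := by rw [nrmP, tg]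
  rw [hQ.fderiv, tdiv_eq hZp, tdiv_eq hNp, hnP]
  have c1 : LinearMap.trace ℝ _ ((A ∘L T.prj : Eu n →L[ℝ] Eu n) : Eu n →ₗ[ℝ] Eu n) =
      LinearMap.trace ℝ _ ((T.prj ∘L A : Vn n →L[ℝ] Vn n) : Vn n →ₗ[ℝ] Vn n) :=
    LinearMap.trace_comp_comm' (T.prj : Eu n →ₗ[ℝ] Vn n) (A : Vn n →ₗ[ℝ] Eu n)
  have c2 : LinearMap.trace ℝ _ ((B ∘L T.prj : Eu n →L[ℝ] Eu n) : Eu n →ₗ[ℝ] Eu n) =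
      LinearMap.trace ℝ _ ((T.prj ∘L B : Vn n →L[ℝ] Vn n) : Vn n →ₗ[ℝ] Vn n) :=
    LinearMap.trace_comp_comm' (T.prj : Eu n →ₗ[ℝ] Vn n) (B : Vn n →ₗ[ℝ] Eu n)
  have c3 : T.prj ∘L B = -((Wd g y)⁻¹ • fderiv ℝ (gradient g) y) +
      ((Wd g y ^ 2)⁻¹ • DW).smulRight (gradient g y) := by
    ext1 v
    simp only [ContinuousLinearMap.comp_apply, hBv, map_sub, map_neg, map_smul, T.prj_inj, T.prj_nrm]
    simp [smul_smul]
    rw [show (Wd g y)⁻¹ * DW v * (Wd g y)⁻¹ = (Wd g y ^ 2)⁻¹ * DW v by field_simp]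
  rw [c1, c2, c3]
  simp only [ContinuousLinearMap.toLinearMap_add, ContinuousLinearMap.toLinearMap_smul,
    ContinuousLinearMap.toLinearMap_neg, map_add, map_neg, map_smul, trace_smulRight', smul_eq_mul,
    ContinuousLinearMap.comp_apply, hNB, T.prj_nrm, inner_neg_right, inner_smul_right]
  have c4 : ⟪Z y, B (gradient g y)⟫ = -((Wd g y)⁻¹ * ⟪T.prj (Z y), fderiv ℝ (gradient g) y (gradient g y)⟫)
      - (Wd g y)⁻¹ * DW (gradient g y) * ⟪Z y, T.nrm g y⟫ := by
    rw [hBv, inner_sub_right, inner_neg_right, inner_smul_right, inner_smul_right,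
      real_inner_comm _ (Z y), T.adj, real_inner_comm (T.prj (Z y))]
  have c5 := hDW (T.prj (Z y))
  rw [← hsym, real_inner_comm] at c5
  simp [fderivInnerCLM_apply, c4, c5]
  rw [real_inner_comm (T.nrm g y) (A (gradient g y))]
  field_simp
  ring


theorem continuous_tdiv {ν X : Eu n → Eu n} (hν : Continuous ν) (hX : ContDiff ℝ 1 X) :
    Continuous (tdiv ν X) := by
  have h : tdiv ν X = fun x => LinearMap.trace ℝ _ (fderiv ℝ X x : Eu n →ₗ[ℝ] Eu n) -
      ⟪ν x, fderiv ℝ X x (ν x)⟫ := by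
    funext x; exact tdiv_eq (hX.differentiable (by norm_num) x).hasFDerivAt
  rw [h]
  have hc : Continuous (fderiv ℝ X) := hX.continuous_fderiv (by norm_num)
  simp only [LinearMap.trace_eq_sum_inner _ (EuclideanSpace.basisFun (Fin (n + 1)) ℝ),
    ContinuousLinearMap.coe_coe]
  fun_prop

theorem tdiv_zero_of_eventuallyEq {ν X : Eu n → Eu n} {x : Eu n} (h : X =ᶠ[𝓝 x] 0) :
    tdiv ν X x = 0 := by
  have h1 : HasFDerivAt X (0 : Eu n →L[ℝ] Eu n) x :=
    (hasFDerivAt_const (0 : Eu n) x).congr_of_eventuallyEq h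
  rw [tdiv_eq h1]; simp

theorem integral_tdiv_Gam {g : Vn n → ℝ} (hg : ContDiff ℝ 2 g) {K : ℝ≥0} (hK : LipschitzWith K g)
    {X : Eu n → Eu n} (hX : ContDiff ℝ 1 X) (hc : HasCompactSupport X) :
    ∫ x in T.Gam g, tdiv (T.nrmP g) X x ∂μH[(n : ℝ)] =
      ∫ x in T.Gam g, tdiv (T.nrmP g) (T.nrmP g) x * ⟪X x, T.nrmP g x⟫ ∂μH[(n : ℝ)] := by
  have hg1 : ContDiff ℝ 1 g := hg.of_le (by norm_num)
  have hNP := T.contDiff_nrmP hg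
  rw [T.integral_Gam hg1 hK (continuous_tdiv hNP.continuous hX),
    T.integral_Gam (G := fun x => tdiv (T.nrmP g) (T.nrmP g) x * ⟪X x, T.nrmP g x⟫) hg1 hK ((continuous_tdiv hNP.continuous hNP).mul (hX.continuous.inner hNP.continuous))]
  have hgr : ContDiff ℝ 1 (T.gr g) := by
    unfold gr; exact T.inj.contDiff.add (hg1.smul contDiff_const)
  set Z : Vn n → Eu n := X ∘ T.gr g with hZd
  have hZ : ContDiff ℝ 1 Z := hX.comp hgr
  have hZc : ∀ y, y ∉ T.prj '' tsupport X → Z y = 0 := by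
    intro y hy
    by_contra h
    exact hy ⟨T.gr g y, subset_tsupport _ h, T.prj_gr g y⟩
  have hKc : IsCompact (T.prj '' tsupport X) := IsCompact.image hc T.prj.continuous
  set Q : Vn n → Vn n := fun y => Wd g y • T.prj (Z y) + ⟪Z y, T.nrm g y⟫ • gradient g y with hQd
  have hQ : ContDiff ℝ 1 Q :=
    ((contDiff_Wd hg).smul (T.prj.contDiff.comp hZ)).add
      ((hZ.inner ℝ (T.contDiff_nrm hg)).smul (contDiff_gradient (l := 1) hg (by norm_num)))
  have hQc : HasCompactSupport Q := by
    apply HasCompactSupport.intro hKc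
    intro y hy
    simp [hQd, hZc y hy]
  have htd : ∀ y, tdiv (T.nrmP g) X (T.gr g y) = tdiv (T.nrmP g) (Z ∘ T.prj) (T.gr g y) := by
    intro y
    apply tdiv_congr_fderiv (by rw [nrmP, T.norm_nrm]) rfl (hX.differentiable (by norm_num) _)
      ((hZ.comp T.prj.contDiff).differentiable (by norm_num) _)
    intro v hv
    rw [nrmP, T.prj_gr] at hv
    have hs := (T.hasStrictFDerivAt_gr (hg1.contDiffAt (x := y) |>.hasStrictFDerivAt (by norm_num))).hasFDerivAt
    have h1 : HasFDerivAt (Z ∘ T.prj) ((fderiv ℝ X (T.gr g y) ∘L T.dgr (fderiv ℝ g y)) ∘L T.prj)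
        (T.gr g y) := by
      apply HasFDerivAt.comp _ _ T.prj.hasFDerivAt
      rw [T.prj_gr]
      exact (hX.differentiable (by norm_num) _).hasFDerivAt.comp y hs
    rw [h1.fderiv]
    simp only [ContinuousLinearMap.comp_apply]
    rw [T.tangent_eq hv]
  have h0 := integral_trace_fderiv hQ hQc
  simp only [hQd] at h0
  simp only [T.div_point hg hZ] at h0
  have hi : ∀ F : Vn n → ℝ, Continuous F → (∀ y, y ∉ T.prj '' tsupport X → F y = 0) →
      Integrable F μH[(n : ℝ)] := fun F h1 h2 =>
    h1.integrable_of_hasCompactSupport (HasCompactSupport.intro hKc h2)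
  have cW : Continuous (Wd g) := (contDiff_Wd hg).continuous
  rw [← sub_eq_zero, ← integral_sub]
  · rw [← h0]
    congr 1
    funext y
    rw [htd, nrmP, T.prj_gr, hZd]
    simp only [Function.comp_apply]
    ring
  · apply hi
    · exact cW.mul ((continuous_tdiv hNP.continuous hX).comp hgr.continuous)
    · intro y hy
      have : T.gr g y ∉ tsupport X := fun h => hy ⟨_, h, T.prj_gr g y⟩
      rw [tdiv_zero_of_eventuallyEq (notMem_tsupport_iff_eventuallyEq.1 this), mul_zero]
  · apply hi
    · exact cW.mul (((continuous_tdiv hNP.continuous hNP).mul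
        (hX.continuous.inner hNP.continuous)).comp hgr.continuous)
    · intro y hy
      have := hZc y hy
      simp only [hZd, Function.comp_apply] at this
      rw [this]; simp

end Frame

theorem cutoff {g0 : Vn n → ℝ} {y0 : Vn n} (h : ContDiffAt ℝ 2 g0 y0) :
    ∃ g : Vn n → ℝ, ContDiff ℝ 2 g ∧ HasCompactSupport g ∧ ∃ δ > 0, ∀ y ∈ ball y0 δ, g y = g0 y := by
  have h1 := h.eventually (by decide)
  obtain ⟨ε, hε, hb⟩ := Metric.eventually_nhds_iff_ball.1 h1
  let χ : ContDiffBump y0 := ⟨ε / 4, ε / 2, by linarith, by linarith⟩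
  refine ⟨fun y => χ y * g0 y, ?_, ?_, ε / 4, by linarith, ?_⟩
  · rw [contDiff_iff_contDiffAt]
    intro y
    by_cases hy : y ∈ ball y0 ε
    · exact χ.contDiff.contDiffAt.mul (hb y hy)
    · have : y ∉ tsupport χ := by
        rw [χ.tsupport_eq]
        intro h
        exact hy (closedBall_subset_ball (by change ε / 2 < ε; linarith) h)
      have h0 : (fun y => χ y * g0 y) =ᶠ[𝓝 y] fun _ => 0 := by
        filter_upwards [notMem_tsupport_iff_eventuallyEq.1 this] with z hz
        rw [hz]; simp
      exact contDiffAt_const.congr_of_eventuallyEq h0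
  · exact χ.hasCompactSupport.mul_right
  · intro y hy
    have : χ y = 1 := χ.one_of_mem_closedBall (ball_subset_closedBall hy)
    simp [this]

theorem chart (M : Hypersurface n) {x0 : Eu n} (hx0 : x0 ∈ M.carrier) :
    ∃ (T : Frame n) (g : Vn n → ℝ) (U : Set (Eu n)), T.e = M.nu x0 ∧ ContDiff ℝ 2 g ∧
      HasCompactSupport g ∧ IsOpen U ∧ x0 ∈ U ∧ Bornology.IsBounded U ∧
      M.carrier ∩ U = T.Gam g ∩ U ∧ ∀ x ∈ M.carrier ∩ U, M.nu x = T.nrmP g x := by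
  obtain ⟨U0, hU0, hxU0, f, hf, hMU, hgne, hnu⟩ := M.locally_level_set x0 hx0
  obtain ⟨T, hT⟩ := Frame.exists_frame (M.nu x0) (M.unit_nu x0 hx0)
  have hfx0 : f x0 = 0 := by
    have : x0 ∈ M.carrier ∩ U0 := ⟨hx0, hxU0⟩
    rw [hMU] at this; exact this.2
  set c := ‖gradient f x0‖ with hc
  have hcpos : 0 < c := norm_pos_iff.2 (hgne x0 hxU0)
  have hgr : gradient f x0 = c • T.e := by
    rw [hT, hnu x0 ⟨hx0, hxU0⟩, smul_smul, mul_inv_cancel₀ hcpos.ne', one_smul]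
  have hf2 : ContDiff ℝ 2 f := hf.of_le (by norm_cast)
  have hfd : ∀ v, fderiv ℝ f x0 v = c * ⟪T.e, v⟫ := by
    intro v
    have : fderiv ℝ f x0 v = ⟪gradient f x0, v⟫ := by simp [gradient]
    rw [this, hgr, inner_smul_left]; simp
  let Ψ : Eu n → Eu n := fun x => T.inj (T.prj x) + f x • T.e
  have hΨ : ContDiff ℝ 2 Ψ := (T.inj.contDiff.comp T.prj.contDiff).add (hf2.smul contDiff_const)
  let Lf : Eu n →L[ℝ] Eu n := T.inj ∘L T.prj + (c • innerSL ℝ T.e).smulRight T.e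
  let Li : Eu n →L[ℝ] Eu n := T.inj ∘L T.prj + (c⁻¹ • innerSL ℝ T.e).smulRight T.e
  have hLf : ∀ v, Lf v = T.inj (T.prj v) + (c * ⟪T.e, v⟫) • T.e := by intro v; simp [Lf]
  have hLi : ∀ v, Li v = T.inj (T.prj v) + (c⁻¹ * ⟪T.e, v⟫) • T.e := by intro v; simp [Li]
  let Le : Eu n ≃L[ℝ] Eu n := ContinuousLinearEquiv.equivOfInverse Lf Li
    (by
      intro v
      rw [hLi, hLf]
      simp only [map_add, map_smul, T.prj_inj, T.prj_e, inner_add_right, T.e_inj, inner_smul_right,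
        T.inner_e_e]
      conv_rhs => rw [← T.split v]
      simp [hcpos.ne'])
    (by
      intro v
      rw [hLi, hLf]
      simp only [map_add, map_smul, T.prj_inj, T.prj_e, inner_add_right, T.e_inj, inner_smul_right,
        T.inner_e_e]
      conv_rhs => rw [← T.split v]
      simp [hcpos.ne'])
  have hd : HasFDerivAt Ψ (Le : Eu n →L[ℝ] Eu n) x0 := by
    have h1 : HasFDerivAt Ψ (T.inj ∘L T.prj + (fderiv ℝ f x0).smulRight T.e) x0 :=
      ((T.inj ∘L T.prj).hasFDerivAt).add
        ((hf2.differentiable (by norm_num) x0).hasFDerivAt.smul_const T.e)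
    convert! h1 using 1
    ext1 v
    change Lf v = _
    rw [hLf]
    simp [hfd]
  have hΨa : ContDiffAt ℝ 2 Ψ x0 := hΨ.contDiffAt
  let P := hΨa.toOpenPartialHomeomorph Ψ hd (by norm_num)
  have hPc : ∀ x, P x = Ψ x := fun x => rfl
  have hΨx0 : Ψ x0 = T.inj (T.prj x0) := by simp [Ψ, hfx0]
  have hs0 : x0 ∈ P.source := hΨa.mem_toOpenPartialHomeomorph_source hd (by norm_num)
  have ht0 : T.inj (T.prj x0) ∈ P.target := by
    rw [← hΨx0]; exact hΨa.image_mem_toOpenPartialHomeomorph_target hd (by norm_num)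
  have hinv : ContDiffAt ℝ 2 P.symm (T.inj (T.prj x0)) := by
    rw [← hΨx0]; exact hΨa.to_localInverse hd (by norm_num)
  have hg0 : ContDiffAt ℝ 2 (fun y => ⟪T.e, P.symm (T.inj y)⟫) (T.prj x0) :=
    contDiffAt_const.inner ℝ (hinv.comp (T.prj x0) T.inj.contDiff.contDiffAt)
  obtain ⟨g, hg, hgc, δ, hδ, hgg⟩ := cutoff hg0
  let U : Set (Eu n) := P.source ∩ U0 ∩ ball x0 1 ∩ T.prj ⁻¹' (ball (T.prj x0) δ) ∩
    (fun x => T.inj (T.prj x)) ⁻¹' P.target ∩ {x | 0 < ⟪M.nu x, T.e⟫}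
  have hUo : IsOpen U := by
    refine IsOpen.inter (IsOpen.inter (IsOpen.inter ((P.open_source.inter hU0).inter isOpen_ball) ?_) ?_) ?_
    · exact isOpen_ball.preimage T.prj.continuous
    · exact P.open_target.preimage (T.inj.continuous.comp T.prj.continuous)
    · exact isOpen_lt continuous_const (M.smooth_nu.continuous.inner continuous_const)
  have hxU : x0 ∈ U := by
    refine ⟨⟨⟨⟨⟨hs0, hxU0⟩, mem_ball_self one_pos⟩, mem_ball_self hδ⟩, ht0⟩, ?_⟩
    change 0 < ⟪M.nu x0, T.e⟫
    rw [← hT, T.inner_e_e]; exact one_pos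
  have hMf : ∀ x ∈ U, (x ∈ M.carrier ↔ f x = 0) := by
    intro x hx
    have hx0' : x ∈ U0 := hx.1.1.1.1.2
    constructor
    · intro h
      have : x ∈ M.carrier ∩ U0 := ⟨h, hx0'⟩
      rw [hMU] at this; exact this.2
    · intro h
      have : x ∈ {y ∈ U0 | f y = 0} := ⟨hx0', h⟩
      rw [← hMU] at this; exact this.1
  have hiff : ∀ x ∈ U, (x ∈ M.carrier ↔ x ∈ T.Gam g) := by
    intro x hx
    obtain ⟨⟨⟨⟨⟨h1, h2⟩, h3⟩, h4⟩, h5⟩, h6⟩ := id hx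
    rw [hMf x hx]
    have hgx := hgg (T.prj x) h4
    change _ ↔ ⟪T.e, x⟫ = g (T.prj x)
    rw [hgx]
    constructor
    · intro hf0
      have : P x = T.inj (T.prj x) := by rw [hPc]; simp [Ψ, hf0]
      rw [← this, P.left_inv h1]
    · intro he
      set z := P.symm (T.inj (T.prj x)) with hz
      have hPz : Ψ z = T.inj (T.prj x) := P.right_inv h5
      have hpz : T.prj z = T.prj x := by
        have := congrArg T.prj hPz
        simpa [Ψ, T.prj_inj, T.prj_e] using this
      have hfz : f z = 0 := by
        have := congrArg (fun w => ⟪T.e, w⟫) hPz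
        simp only [Ψ, inner_add_right, T.e_inj, inner_smul_right, T.inner_e_e] at this
        linarith
      have : z = x := by
        rw [← T.split z, ← T.split x, hpz, he]
      rw [← this]; exact hfz
  refine ⟨T, g, U, hT, hg, hgc, hUo, hxU, isBounded_ball.subset (fun x hx => hx.1.1.1.2), ?_, ?_⟩
  · ext x
    constructor
    · rintro ⟨h1, h2⟩; exact ⟨(hiff x h2).1 h1, h2⟩
    · rintro ⟨h1, h2⟩; exact ⟨(hiff x h2).2 h1, h2⟩
  · rintro x ⟨hxM, hx⟩
    have hxG : x ∈ T.Gam g := (hiff x hx).1 hxM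
    have hgx : T.gr g (T.prj x) = x := T.gr_prj hxG
    have hg1 : ContDiff ℝ 1 g := hg.of_le (by norm_num)
    have hs := (T.hasStrictFDerivAt_gr (hg1.contDiffAt (x := T.prj x) |>.hasStrictFDerivAt
      (by norm_num))).hasFDerivAt
    have hcomp : HasFDerivAt (f ∘ T.gr g) (fderiv ℝ f x ∘L T.dgr (fderiv ℝ g (T.prj x))) (T.prj x) := by
      apply HasFDerivAt.comp _ _ hs
      rw [hgx]; exact (hf2.differentiable (by norm_num) x).hasFDerivAt
    have hev : (f ∘ T.gr g) =ᶠ[𝓝 (T.prj x)] fun _ => 0 := by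
      have hcont : ContinuousAt (T.gr g) (T.prj x) := hs.continuousAt
      have hUn : U ∈ 𝓝 (T.gr g (T.prj x)) := by rw [hgx]; exact hUo.mem_nhds hx
      filter_upwards [hcont hUn] with y hy
      exact (hMf _ hy).1 ((hiff _ hy).2 (T.gr_mem g y))
    have h0 := hcomp.unique ((hasFDerivAt_const (0 : ℝ) _).congr_of_eventuallyEq hev)
    have h1 : ∀ v, ⟪M.nu x, T.dgr (fderiv ℝ g (T.prj x)) v⟫ = 0 := by
      intro v
      have h2 := congrArg (fun L => L v) h0
      have h3 : fderiv ℝ f x (T.dgr (fderiv ℝ g (T.prj x)) v) = 0 := h2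
      have h4 : ∀ w, fderiv ℝ f x w = ⟪gradient f x, w⟫ := by intro w; simp [gradient]
      rw [hnu x ⟨hxM, hx.1.1.1.1.2⟩, inner_smul_left, ← h4, h3, mul_zero]
    set t := ⟪M.nu x, T.e⟫ with ht
    have htp : 0 < t := hx.2
    have h2 : T.prj (M.nu x) = -(t • gradient g (T.prj x)) := by
      apply ext_inner_right ℝ
      intro v
      have := h1 v
      rw [T.dgr_apply, inner_add_right, inner_smul_right, real_inner_comm, T.adj, real_inner_comm,
        Frame.fderiv_eq_inner] at this
      rw [inner_neg_left, inner_smul_left]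
      simp only [conj_trivial]
      linarith
    have h3 : M.nu x = t • (T.e - T.inj (gradient g (T.prj x))) := by
      rw [← T.split (M.nu x), h2, real_inner_comm, map_neg, map_smul, smul_sub]
      abel
    have h4 : t * Frame.Wd g (T.prj x) = 1 := by
      have h5 := M.unit_nu x hxM
      rw [h3, norm_smul, Real.norm_of_nonneg htp.le] at h5
      have h6 := T.norm_sub_inj (gradient g (T.prj x))
      rw [← Frame.Wd_sq] at h6
      rwa [(sq_eq_sq₀ (norm_nonneg _) (Frame.Wd_pos g _).le).1 h6] at h5
    rw [Frame.nrmP, Frame.nrm, h3, eq_inv_of_mul_eq_one_left h4]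

theorem isLocallyClosed_carrier (M : Hypersurface n) : IsLocallyClosed M.carrier := by
  apply ((isLocallyClosed_tfae M.carrier).out 0 3).2
  intro x hx
  obtain ⟨T, g, U, hT, hg, hgc, hU, hxU, hb, hMU, hn⟩ := chart M hx
  refine ⟨U, hxU, hU, ?_⟩
  rintro y ⟨hy, hyc⟩
  have h1 : y ∈ closure (M.carrier ∩ U) := by
    rw [inter_comm]; exact hU.inter_closure ⟨hy, hyc⟩
  rw [hMU] at h1
  have h2 : y ∈ T.Gam g := by
    have := closure_mono inter_subset_left h1
    rwa [(T.isClosed_Gam hg.continuous).closure_eq] at this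
  have : y ∈ M.carrier ∩ U := by rw [hMU]; exact ⟨h2, hy⟩
  exact this.1

theorem measurableSet_carrier (M : Hypersurface n) : MeasurableSet M.carrier := by
  obtain ⟨U, Z, hU, hZ, h⟩ := isLocallyClosed_carrier M
  rw [h]; exact hU.measurableSet.inter hZ.measurableSet

theorem ae_mem (M : Hypersurface n) : ∀ᵐ x ∂surfMeasure M, x ∈ M.carrier :=
  ae_restrict_mem (measurableSet_carrier M)

theorem tan_eq (M : Hypersurface n) {F : Type*} [NormedAddCommGroup F] [NormedSpace ℝ F]
    {X Y : Eu n → F} {x : Eu n} (hx : x ∈ M.carrier) (hX : DifferentiableAt ℝ X x)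
    (hY : DifferentiableAt ℝ Y x) (h : ∀ᶠ y in 𝓝 x, y ∈ M.carrier → X y = Y y) (v : Eu n)
    (hv : ⟪M.nu x, v⟫ = 0) : fderiv ℝ X x v = fderiv ℝ Y x v := by
  obtain ⟨T, g, U, hT, hg, hgc, hU, hxU, hb, hMU, hnu⟩ := chart M hx
  have hg1 : ContDiff ℝ 1 g := hg.of_le (by norm_num)
  have hxG : x ∈ T.Gam g := by
    have : x ∈ M.carrier ∩ U := ⟨hx, hxU⟩
    rw [hMU] at this; exact this.1
  have hgx : T.gr g (T.prj x) = x := T.gr_prj hxG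
  have hs := (T.hasStrictFDerivAt_gr (hg1.contDiffAt (x := T.prj x) |>.hasStrictFDerivAt
      (by norm_num))).hasFDerivAt
  have hc : ∀ {X : Eu n → F}, DifferentiableAt ℝ X x →
      HasFDerivAt (X ∘ T.gr g) (fderiv ℝ X x ∘L T.dgr (fderiv ℝ g (T.prj x))) (T.prj x) := by
    intro X hX
    apply HasFDerivAt.comp _ _ hs
    rw [hgx]; exact hX.hasFDerivAt
  have hev : (X ∘ T.gr g) =ᶠ[𝓝 (T.prj x)] (Y ∘ T.gr g) := by
    have hcont : ContinuousAt (T.gr g) (T.prj x) := hs.continuousAt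
    have hUn : U ∈ 𝓝 (T.gr g (T.prj x)) := by rw [hgx]; exact hU.mem_nhds hxU
    rw [← hgx] at h
    filter_upwards [hcont hUn, hcont.eventually h] with y hy hy2
    apply hy2
    have : T.gr g y ∈ T.Gam g ∩ U := ⟨T.gr_mem g y, hy⟩
    rw [← hMU] at this; exact this.1
  have h0 := (hc hX).unique ((hc hY).congr_of_eventuallyEq hev)
  have h1 := congrArg (fun L => L (T.prj v)) h0
  simp only [ContinuousLinearMap.comp_apply] at h1
  rw [hnu x ⟨hx, hxU⟩] at hv
  rwa [T.tangent_eq hv] at h1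

theorem tdiv_congr_M (M : Hypersurface n) {X Y : Eu n → Eu n} {x : Eu n} (hx : x ∈ M.carrier)
    (hX : DifferentiableAt ℝ X x)
    (hY : DifferentiableAt ℝ Y x) (h : ∀ᶠ y in 𝓝 x, y ∈ M.carrier → X y = Y y)  :
    tdiv M.nu X x = tdiv M.nu Y x :=
  tdiv_congr_fderiv (M.unit_nu x hx) rfl hX hY (tan_eq M hx hX hY h)

theorem tgrad_zero_M (M : Hypersurface n) {φ : Eu n → ℝ} {x : Eu n} (hx : x ∈ M.carrier)
    (hX : DifferentiableAt ℝ φ x) (h : ∀ᶠ y in 𝓝 x, y ∈ M.carrier → φ y = 0)  :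
    tgrad M.nu φ x = 0 := by
  rw [tgrad_congr_fderiv (ψ := fun _ => 0) (M.unit_nu x hx)
    (tan_eq M hx hX (differentiableAt_const _) h)]
  simp [tgrad, gradient]

theorem tdiv_zero (ν : Eu n → Eu n) (x : Eu n) : tdiv ν (fun _ => 0) x = 0 :=
  Frame.tdiv_zero_of_eventuallyEq (Eventually.of_forall fun _ => rfl)

theorem contDiff_nu (M : Hypersurface n) : ContDiff ℝ 1 M.nu := M.smooth_nu.of_le (by norm_cast)

theorem continuous_meanCurv (M : Hypersurface n) : Continuous (meanCurv M) :=
  Frame.continuous_tdiv (contDiff_nu M).continuous (contDiff_nu M)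

theorem continuous_tgrad (M : Hypersurface n) {φ : Eu n → ℝ} (h : ContDiff ℝ 1 φ) :
    Continuous (tgrad M.nu φ) := by
  have h1 := Frame.continuous_gradient' h
  have h2 := (contDiff_nu M).continuous
  unfold tgrad
  fun_prop

theorem local_integral (M : Hypersurface n) {T : Frame n} {g : Vn n → ℝ} {U : Set (Eu n)}
    (hU : IsOpen U) (hMU : M.carrier ∩ U = T.Gam g ∩ U) {F : Eu n → ℝ} (hF : ∀ x, x ∉ U → F x = 0) :
    ∫ x, F x ∂surfMeasure M = ∫ x in T.Gam g, F x ∂μH[(n : ℝ)] := by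
  rw [← setIntegral_eq_integral_of_forall_compl_eq_zero hF,
    ← setIntegral_eq_integral_of_forall_compl_eq_zero (μ := (μH[(n : ℝ)]).restrict (T.Gam g)) hF,
    surfMeasure, Measure.restrict_restrict hU.measurableSet, Measure.restrict_restrict hU.measurableSet,
    inter_comm, hMU, inter_comm]

theorem local_variation (M : Hypersurface n) {T : Frame n} {g : Vn n → ℝ} {U : Set (Eu n)}
    (hg : ContDiff ℝ 2 g) (hgc : HasCompactSupport g)
    (hU : IsOpen U) (hMU : M.carrier ∩ U = T.Gam g ∩ U)
    (hnu : ∀ x ∈ M.carrier ∩ U, M.nu x = T.nrmP g x) {X : Eu n → Eu n} (hX : ContDiff ℝ 1 X)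
    (hXc : HasCompactSupport X) (hXU : tsupport X ⊆ U) :
    ∫ x, tdiv M.nu X x ∂surfMeasure M = ∫ x, meanCurv M x * ⟪X x, M.nu x⟫ ∂surfMeasure M := by
  obtain ⟨K, hK⟩ := hg.lipschitzWith_of_hasCompactSupport hgc (by norm_num)
  have hz : ∀ ν x, x ∉ U → tdiv ν X x = 0 := fun ν x hx =>
    Frame.tdiv_zero_of_eventuallyEq (notMem_tsupport_iff_eventuallyEq.1 fun h => hx (hXU h))
  have hz0 : ∀ x, x ∉ U → X x = 0 := fun x hx => image_eq_zero_of_notMem_tsupport fun h => hx (hXU h)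
  rw [local_integral M hU hMU (hz _), local_integral M hU hMU (by intro x hx; simp [hz0 x hx])]
  have hN := T.contDiff_nrmP hg
  rw [setIntegral_congr_fun (g := fun x => tdiv (T.nrmP g) X x) (T.isClosed_Gam hg.continuous).measurableSet,
    T.integral_tdiv_Gam hg hK hX hXc]
  · apply setIntegral_congr_fun (T.isClosed_Gam hg.continuous).measurableSet
    intro x hx
    by_cases hxU : x ∈ U
    · have hxM : x ∈ M.carrier ∩ U := by rw [hMU]; exact ⟨hx, hxU⟩
      have : meanCurv M x = tdiv (T.nrmP g) (T.nrmP g) x := by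
        apply tdiv_congr_fderiv (M.unit_nu x hxM.1) (hnu x hxM).symm
          ((contDiff_nu M).differentiable (by norm_num) x) (hN.differentiable (by norm_num) x)
        apply tan_eq M hxM.1 ((contDiff_nu M).differentiable (by norm_num) x)
          (hN.differentiable (by norm_num) x)
        filter_upwards [hU.mem_nhds hxU] with y hy hyM using hnu y ⟨hyM, hy⟩
      simp only [this, hnu x hxM]
    · simp [hz0 x hxU]
  · intro x hx
    by_cases hxU : x ∈ U
    · have hxM : x ∈ M.carrier ∩ U := by rw [hMU]; exact ⟨hx, hxU⟩
      have hd := hX.differentiable (by norm_num) x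
      exact tdiv_congr_fderiv (M.unit_nu x hxM.1) (hnu x hxM).symm hd hd (fun v _ => rfl)
    · simp only [hz _ x hxU]

theorem chart_finite (M : Hypersurface n) {x : Eu n} (hx : x ∈ M.carrier) :
    ∃ U ∈ 𝓝 x, surfMeasure M U < ∞ := by
  obtain ⟨T, g, U, hT, hg, hgc, hU, hxU, hb, hMU, hnu⟩ := chart M hx
  obtain ⟨K, hK⟩ := hg.lipschitzWith_of_hasCompactSupport hgc (by norm_num)
  refine ⟨U, hU.mem_nhds hxU, ?_⟩
  rw [surfMeasure, Measure.restrict_apply hU.measurableSet, inter_comm, hMU]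
  obtain ⟨R, hR⟩ := hb.subset_closedBall 0
  have hsub : T.Gam g ∩ U ⊆ T.gr g '' (closedBall 0 R) := by
    rintro y ⟨h1, h2⟩
    refine ⟨T.prj y, ?_, T.gr_prj h1⟩
    have := hR h2
    simp only [mem_closedBall, dist_zero_right] at this ⊢
    exact (T.norm_prj_le y).trans this
  refine (measure_mono hsub).trans_lt ?_
  rw [← T.lam_apply g isClosed_closedBall.measurableSet]
  refine (T.lam_le hK isClosed_closedBall.measurableSet).trans_lt ?_
  refine ENNReal.mul_lt_top (ENNReal.rpow_lt_top_of_nonneg (by positivity) ENNReal.coe_ne_top) ?_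
  exact (isCompact_closedBall (0 : Vn n) R).measure_lt_top

theorem compact_finite (M : Hypersurface n) {K : Set (Eu n)} (hK : IsCompact K)
    (hKM : K ⊆ M.carrier) : surfMeasure M K < ∞ :=
  hK.measure_lt_top_of_nhdsWithin fun x hx => by
    obtain ⟨U, hU, h⟩ := chart_finite M (hKM hx)
    exact ⟨U, mem_nhdsWithin_of_mem_nhds hU, h⟩

theorem integrable_M (M : Hypersurface n) {K : Set (Eu n)} (hK : IsCompact K)
    (hKM : K ⊆ M.carrier) {G : Eu n → ℝ} (hG : Continuous G) (h0 : ∀ x ∈ M.carrier, x ∉ K → G x = 0) :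
    Integrable G (surfMeasure M) := by
  have h1 : IntegrableOn G K (surfMeasure M) := by
    exact ContinuousOn.integrableOn_of_subset_isCompact hG.continuousOn hK hK.measurableSet subset_rfl
      (compact_finite M hK hKM).ne
  apply h1.integrable_of_ae_notMem_eq_zero
  filter_upwards [ae_mem M] with x hx hxK using h0 x hx hxK

theorem tdiv_zero_off (M : Hypersurface n) {K : Set (Eu n)} (hK : IsCompact K)
    {X : Eu n → Eu n} (hX : ContDiff ℝ 1 X) (h0 : ∀ x ∈ M.carrier, x ∉ K → X x = 0) :
    ∀ x ∈ M.carrier, x ∉ K → tdiv M.nu X x = 0 := by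
  intro x hx hxK
  rw [tdiv_congr_M M hx (Y := fun _ => 0) (hX.differentiable (by norm_num) x) (differentiableAt_const _),
    tdiv_zero]
  filter_upwards [hK.isClosed.isOpen_compl.mem_nhds hxK] with y hy hyM using h0 y hyM hy

theorem tgrad_zero_off (M : Hypersurface n) {K : Set (Eu n)} (hK : IsCompact K)
    {X : Eu n → ℝ} (hX : ContDiff ℝ 1 X) (h0 : ∀ x ∈ M.carrier, x ∉ K → X x = 0) :
    ∀ x ∈ M.carrier, x ∉ K → tgrad M.nu X x = 0 := by
  intro x hx hxK
  apply tgrad_zero_M M hx (hX.differentiable (by norm_num) x)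
  filter_upwards [hK.isClosed.isOpen_compl.mem_nhds hxK] with y hy hyM using h0 y hyM hy

theorem tdiv_sum {ι : Type*} (s : Finset ι) (ν : Eu n → Eu n) (X : ι → Eu n → Eu n) (x : Eu n)
    (hX : ∀ i, DifferentiableAt ℝ (X i) x) :
    tdiv ν (fun y => ∑ i ∈ s, X i y) x = ∑ i ∈ s, tdiv ν (X i) x := by
  have h : HasFDerivAt (fun y => ∑ i ∈ s, X i y) (∑ i ∈ s, fderiv ℝ (X i) x) x :=
    HasFDerivAt.fun_sum fun i _ => (hX i).hasFDerivAt
  rw [tdiv_eq h, Finset.sum_congr rfl (fun i _ => tdiv_eq (hX i).hasFDerivAt), Finset.sum_sub_distrib]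
  congr 1
  · rw [← map_sum]; congr 1; ext v; simp
  · rw [← inner_sum]; simp

open scoped Manifold ContDiff in
theorem first_variation (M : Hypersurface n) {K : Set (Eu n)} (hK : IsCompact K)
    (hKM : K ⊆ M.carrier) {X : Eu n → Eu n} (hX : ContDiff ℝ 1 X)
    (h0 : ∀ x ∈ M.carrier, x ∉ K → X x = 0) :
    ∫ x, tdiv M.nu X x ∂surfMeasure M = ∫ x, meanCurv M x * ⟪X x, M.nu x⟫ ∂surfMeasure M := by
  choose! T g U hT hg hgc hU hxU hb hMU hnu using fun (x : Eu n) (hx : x ∈ M.carrier) => chart M hx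
  obtain ⟨t, ht, hcov⟩ := hK.elim_nhds_subcover U (fun x hx => (hU x (hKM hx)).mem_nhds (hxU x (hKM hx)))
  obtain ⟨ρ, hρ⟩ := SmoothPartitionOfUnity.exists_isSubordinate 𝓘(ℝ, Eu n) hK.isClosed
    (fun i : t => U i) (fun i => hU i (hKM (ht i i.2))) (by
      intro x hx
      obtain ⟨i, hi, hxi⟩ := mem_iUnion₂.1 (hcov hx)
      exact mem_iUnion.2 ⟨⟨i, hi⟩, hxi⟩)
  have hρs : ∀ i, ContDiff ℝ 1 (ρ i) := fun i => by
    have := (ρ i).contMDiff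
    exact this.contDiff.of_le (by norm_cast)
  let Y : t → Eu n → Eu n := fun i x => ρ i x • X x
  have hY : ∀ i, ContDiff ℝ 1 (Y i) := fun i => (hρs i).smul hX
  have hY0 : ∀ i, ∀ x ∈ M.carrier, x ∉ K → Y i x = 0 := by
    intro i x hx hxK; simp [Y, h0 x hx hxK]
  have hsum : ∀ x ∈ M.carrier, X x = ∑ i, Y i x := by
    intro x hx
    by_cases hxK : x ∈ K
    · have := ρ.sum_eq_one hxK
      rw [finsum_eq_sum_of_fintype] at this
      simp only [Y]
      rw [← Finset.sum_smul, this, one_smul]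
    · rw [h0 x hx hxK, Finset.sum_eq_zero]
      intro i _; exact hY0 i x hx hxK
  have hloc : ∀ i, ∫ x, tdiv M.nu (Y i) x ∂surfMeasure M =
      ∫ x, meanCurv M x * ⟪Y i x, M.nu x⟫ ∂surfMeasure M := by
    intro i
    have hi := hKM (ht i i.2)
    have hts : tsupport (Y i) ⊆ tsupport (ρ i) := by
      apply closure_mono
      intro x hx h
      apply hx; simp [Y, h]
    have hsub : tsupport (Y i) ⊆ U i := hts.trans (hρ i)
    refine local_variation M (hg _ hi) (hgc _ hi) (hU _ hi) (hMU _ hi) (hnu _ hi) (hY i) ?_ hsub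
    exact Metric.isCompact_of_isClosed_isBounded (isClosed_tsupport _) ((hb _ hi).subset hsub)
  have cH := continuous_meanCurv M
  have cν := (contDiff_nu M).continuous
  calc ∫ x, tdiv M.nu X x ∂surfMeasure M
      = ∫ x, ∑ i, tdiv M.nu (Y i) x ∂surfMeasure M := by
        apply integral_congr_ae
        filter_upwards [ae_mem M] with x hx
        rw [← tdiv_sum _ _ _ _ (fun i => (hY i).differentiable (by norm_num) x)]
        apply tdiv_congr_M M hx (hX.differentiable (by norm_num) x)
        · exact (ContDiff.sum fun i _ => hY i).differentiable (by norm_num) x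
        · filter_upwards with y hy using hsum y hy
    _ = ∑ i, ∫ x, tdiv M.nu (Y i) x ∂surfMeasure M := by
        apply integral_finsetSum
        intro i _
        exact integrable_M M hK hKM (Frame.continuous_tdiv cν (hY i)) (tdiv_zero_off M hK (hY i) (hY0 i))
    _ = ∑ i, ∫ x, meanCurv M x * ⟪Y i x, M.nu x⟫ ∂surfMeasure M := by
        apply Finset.sum_congr rfl; intro i _; exact hloc i
    _ = ∫ x, ∑ i, meanCurv M x * ⟪Y i x, M.nu x⟫ ∂surfMeasure M := by
        rw [integral_finsetSum]
        intro i _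
        refine integrable_M M hK hKM (cH.mul ((hY i).continuous.inner cν)) ?_
        intro x hx hxK; simp [hY0 i x hx hxK]
    _ = _ := by
        apply integral_congr_ae
        filter_upwards [ae_mem M] with x hx
        rw [hsum x hx, sum_inner, Finset.mul_sum]

/-- volume of the unit ball -/
def c2 (n : ℕ) : ℝ := (1 / 2) ^ n * (μH[(n : ℝ)] (closedBall (0 : Vn n) 1)).toReal

theorem c2_pos : 0 < c2 n := by
  unfold c2
  have h1 : μH[(n : ℝ)] (closedBall (0 : Vn n) 1) < ∞ := (isCompact_closedBall (0 : Vn n) 1).measure_lt_top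
  have h2 : 0 < μH[(n : ℝ)] (closedBall (0 : Vn n) 1) := measure_closedBall_pos _ _ one_pos
  have := ENNReal.toReal_pos h2.ne' h1.ne
  positivity

theorem density (M : Hypersurface n) {ξ : Eu n} (hξ : ξ ∈ M.carrier) :
    ∃ s0 > 0, ∀ s, 0 < s → s ≤ s0 → ENNReal.ofReal (c2 n * s ^ n) ≤ surfMeasure M (closedBall ξ s) := by
  obtain ⟨T, g, U, hT, hg, hgc, hU, hxU, hb, hMU, hnu⟩ := chart M hξ
  have hξG : ξ ∈ T.Gam g := by
    have : ξ ∈ M.carrier ∩ U := ⟨hξ, hxU⟩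
    rw [hMU] at this; exact this.1
  have hgx : T.gr g (T.prj ξ) = ξ := T.gr_prj hξG
  set y0 := T.prj ξ with hy0
  have hgrad : gradient g y0 = 0 := by
    have h1 := hnu ξ ⟨hξ, hxU⟩
    rw [← hT] at h1
    have h2 := congrArg T.prj h1
    rw [T.prj_e, Frame.nrmP, T.prj_nrm] at h2
    have h3 := neg_eq_zero.1 h2.symm
    exact (smul_eq_zero.1 h3).resolve_left (inv_ne_zero (Frame.Wd_pos g _).ne')
  have hfd : HasFDerivAt g (0 : Vn n →L[ℝ] ℝ) y0 := by
    have h1 := (hg.differentiable (by norm_num) y0).hasFDerivAt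
    have h2 : fderiv ℝ g y0 = 0 := by
      ext v; rw [Frame.fderiv_eq_inner, hgrad]; simp
    rwa [h2] at h1
  have hev := hfd.isLittleO.bound (c := 1) one_pos
  obtain ⟨δ1, hδ1, hb1⟩ := Metric.eventually_nhds_iff_ball.1 hev
  obtain ⟨δ2, hδ2, hb2⟩ := Metric.isOpen_iff.1 hU ξ hxU
  refine ⟨min (δ1 / 2) (δ2 / 2), by positivity, ?_⟩
  intro s hs hs0
  have hs1 : s ≤ δ1 / 2 := hs0.trans (min_le_left _ _)
  have hs2 : s ≤ δ2 / 2 := hs0.trans (min_le_right _ _)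
  have hsub : closedBall y0 (s / 2) ⊆ T.prj '' (closedBall ξ s ∩ M.carrier) := by
    intro y hy
    refine ⟨T.gr g y, ?_, T.prj_gr g y⟩
    have hyn : ‖y - y0‖ ≤ s / 2 := by rwa [mem_closedBall, dist_eq_norm] at hy
    have h1 := hb1 y (by rw [mem_ball, dist_eq_norm]; linarith)
    simp only [zero_apply, sub_zero, one_mul, Real.norm_eq_abs] at h1
    have h2 : T.gr g y - ξ = T.inj (y - y0) + (g y - g y0) • T.e := by
      conv_lhs => rw [← hgx]
      simp only [Frame.gr, map_sub, sub_smul]; abel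
    have h3 : ‖T.gr g y - ξ‖ ^ 2 ≤ s ^ 2 := by
      rw [h2, T.norm_sq_add]
      have h4 : (g y - g y0) ^ 2 ≤ (s / 2) ^ 2 := sq_le_sq' (by linarith [abs_le.1 (h1.trans hyn)]) (by linarith [abs_le.1 (h1.trans hyn)])
      have h5 : ‖y - y0‖ ^ 2 ≤ (s / 2) ^ 2 := pow_le_pow_left₀ (norm_nonneg _) hyn 2
      nlinarith
    have h6 : T.gr g y ∈ closedBall ξ s := by
      rw [mem_closedBall, dist_eq_norm]
      exact (sq_le_sq₀ (norm_nonneg _) hs.le).1 h3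
    have h7 : T.gr g y ∈ U := hb2 (closedBall_subset_ball (by linarith) h6)
    have h8 : T.gr g y ∈ M.carrier ∩ U := by rw [hMU]; exact ⟨T.gr_mem g y, h7⟩
    exact ⟨h6, h8.1⟩
  have hlip : LipschitzWith 1 T.prj := by
    apply LipschitzWith.of_dist_le_mul
    intro x y
    rw [dist_eq_norm, dist_eq_norm, ← map_sub]; simpa using T.norm_prj_le (x - y)
  have h1 := hlip.hausdorffMeasure_image_le (d := (n : ℝ)) (by positivity) (closedBall ξ s ∩ M.carrier)
  rw [surfMeasure, Measure.restrict_apply isClosed_closedBall.measurableSet]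
  have h2 := (measure_mono hsub).trans h1
  rw [ENNReal.coe_one, ENNReal.one_rpow, one_mul] at h2
  refine le_trans (le_of_eq ?_) h2
  rw [Measure.addHaar_closedBall' _ _ (by positivity : (0:ℝ) ≤ s / 2), finrank_euclideanSpace, Fintype.card_fin]
  have hfin : μH[(n : ℝ)] (closedBall (0 : Vn n) 1) < ∞ := (isCompact_closedBall (0 : Vn n) 1).measure_lt_top
  rw [c2]
  conv_rhs => rw [← ENNReal.ofReal_toReal hfin.ne]
  rw [← ENNReal.ofReal_mul (by positivity)]
  congr 1
  rw [div_pow, div_pow, one_pow]; ring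

/-- gradient density -/
def hh (M : Hypersurface n) (u : Eu n → ℝ) (x : Eu n) : ℝ :=
  ‖tgrad M.nu u x‖ + |meanCurv M x| * u x

/-- admissible test functions -/
structure Adm (M : Hypersurface n) (K : Set (Eu n)) (u : Eu n → ℝ) : Prop where
  cpt : IsCompact K
  sub : K ⊆ M.carrier
  smooth : ContDiff ℝ 1 u
  nonneg : ∀ x, 0 ≤ u x
  zero : ∀ x ∈ M.carrier, x ∉ K → u x = 0

namespace Adm
variable {M : Hypersurface n} {K : Set (Eu n)} {u : Eu n → ℝ} (h : Adm M K u)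
include h

theorem hh_nonneg (x : Eu n) : 0 ≤ hh M u x := by
  have := h.nonneg x; unfold hh; positivity

theorem hh_cont : Continuous (hh M u) := by
  have h1 := continuous_tgrad M h.smooth
  have h2 := continuous_meanCurv M
  have h3 := h.smooth.continuous
  unfold hh; fun_prop

theorem hh_zero : ∀ x ∈ M.carrier, x ∉ K → hh M u x = 0 := by
  intro x hx hxK
  simp [hh, tgrad_zero_off M h.cpt h.smooth h.zero x hx hxK, h.zero x hx hxK]

theorem int_mul {G : Eu n → ℝ} (hG : Continuous G) : Integrable (fun x => u x * G x) (surfMeasure M) :=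
  integrable_M M h.cpt h.sub (h.smooth.continuous.mul hG) fun x hx hxK => by simp [h.zero x hx hxK]

theorem int_hh_mul {G : Eu n → ℝ} (hG : Continuous G) :
    Integrable (fun x => hh M u x * G x) (surfMeasure M) :=
  integrable_M M h.cpt h.sub (h.hh_cont.mul hG) fun x hx hxK => by simp [h.hh_zero x hx hxK]

theorem int_u : Integrable u (surfMeasure M) :=
  integrable_M M h.cpt h.sub h.smooth.continuous h.zero

theorem int_hh : Integrable (hh M u) (surfMeasure M) :=
  integrable_M M h.cpt h.sub h.hh_cont h.hh_zero

theorem key {Y : Eu n → Eu n} (hY : ContDiff ℝ 1 Y) :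
    ∫ x, u x * tdiv M.nu Y x ∂surfMeasure M ≤ ∫ x, hh M u x * ‖Y x‖ ∂surfMeasure M := by
  have cν := (contDiff_nu M).continuous
  have hX : ContDiff ℝ 1 (fun x => u x • Y x) := h.smooth.smul hY
  have hv := first_variation M h.cpt h.sub hX (fun x hx hxK => by simp [h.zero x hx hxK])
  have e1 : ∀ x, tdiv M.nu (fun x => u x • Y x) x = u x * tdiv M.nu Y x + ⟪tgrad M.nu u x, Y x⟫ :=
    fun x => tdiv_smul (h.smooth.differentiable (by norm_num) x) (hY.differentiable (by norm_num) x)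
  simp only [e1] at hv
  have i1 := h.int_mul (Frame.continuous_tdiv cν hY)
  have i2 : Integrable (fun x => ⟪tgrad M.nu u x, Y x⟫) (surfMeasure M) :=
    integrable_M M h.cpt h.sub ((continuous_tgrad M h.smooth).inner hY.continuous) fun x hx hxK => by
      simp [tgrad_zero_off M h.cpt h.smooth h.zero x hx hxK]
  have i3 : Integrable (fun x => meanCurv M x * ⟪u x • Y x, M.nu x⟫) (surfMeasure M) :=
    integrable_M M h.cpt h.sub ((continuous_meanCurv M).mul (hX.continuous.inner cν)) fun x hx hxK => by
      simp [h.zero x hx hxK]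
  rw [integral_add i1 i2] at hv
  have : ∫ x, u x * tdiv M.nu Y x ∂surfMeasure M =
      ∫ x, (meanCurv M x * ⟪u x • Y x, M.nu x⟫ - ⟪tgrad M.nu u x, Y x⟫) ∂surfMeasure M := by
    rw [integral_sub i3 i2]; linarith
  rw [this]
  apply integral_mono_ae (i3.sub i2) (h.int_hh_mul hY.continuous.norm)
  filter_upwards [ae_mem M] with x hx
  have a1 : -⟪tgrad M.nu u x, Y x⟫ ≤ ‖tgrad M.nu u x‖ * ‖Y x‖ := by
    have := abs_real_inner_le_norm (tgrad M.nu u x) (Y x)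
    linarith [neg_abs_le ⟪tgrad M.nu u x, Y x⟫]
  have a2 : meanCurv M x * ⟪u x • Y x, M.nu x⟫ ≤ |meanCurv M x| * u x * ‖Y x‖ := by
    have h1 := abs_real_inner_le_norm (u x • Y x) (M.nu x)
    rw [M.unit_nu x hx, mul_one, norm_smul, Real.norm_of_nonneg (h.nonneg x)] at h1
    calc _ ≤ |meanCurv M x * ⟪u x • Y x, M.nu x⟫| := le_abs_self _
      _ = |meanCurv M x| * |⟪u x • Y x, M.nu x⟫| := abs_mul _ _
      _ ≤ |meanCurv M x| * (u x * ‖Y x‖) := by gcongr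
      _ = _ := by ring
  simp only [hh, Pi.sub_apply]
  nlinarith
end Adm

/-- radial field -/
def rad (ξ : Eu n) (ε α : ℝ) (x : Eu n) : Eu n := (‖x - ξ‖ ^ 2 + ε) ^ (-α) • (x - ξ)

theorem rad_smooth (ξ : Eu n) {ε : ℝ} (hε : 0 < ε) (α : ℝ) : ContDiff ℝ 1 (rad ξ ε α) := by
  unfold rad
  have h : ContDiff ℝ 1 (fun x : Eu n => ‖x - ξ‖ ^ 2 + ε) :=
    ((contDiff_id.sub contDiff_const).norm_sq ℝ).add contDiff_const
  exact (h.rpow_const_of_ne (fun x => by positivity)).smul (contDiff_id.sub contDiff_const)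

theorem rad_tdiv (M : Hypersurface n) (ξ : Eu n) {ε : ℝ} (hε : 0 < ε) {α : ℝ} (hα : 0 ≤ α) {x : Eu n}
    (hx : x ∈ M.carrier) :
    (‖x - ξ‖ ^ 2 + ε) ^ (-α - 1) * ((n - 2 * α) * ‖x - ξ‖ ^ 2 + n * ε) ≤ tdiv M.nu (rad ξ ε α) x := by
  have hq : 0 < ‖x - ξ‖ ^ 2 + ε := by positivity
  have h1 : HasFDerivAt (fun x : Eu n => ‖x - ξ‖ ^ 2 + ε) (2 • innerSL ℝ (x - ξ)) x := by
    have := ((hasFDerivAt_id (𝕜 := ℝ) x).sub_const ξ).norm_sq.add_const ε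
    simpa using! this
  have h2 := h1.rpow_const (p := -α) (Or.inl hq.ne')
  have h3 : HasFDerivAt (fun x : Eu n => x - ξ) (ContinuousLinearMap.id ℝ (Eu n)) x :=
    (hasFDerivAt_id x).sub_const ξ
  have hid : tdiv M.nu (fun x => x - ξ) x = n := by
    rw [tdiv_eq h3]
    have : LinearMap.trace ℝ (Eu n) ((ContinuousLinearMap.id ℝ (Eu n)) : Eu n →ₗ[ℝ] Eu n) = n + 1 := by
      have := LinearMap.trace_id ℝ (Eu n)
      simpa using! this
    rw [this]
    simp [M.unit_nu x hx]
  have h4 : tdiv M.nu (rad ξ ε α) x = (‖x - ξ‖ ^ 2 + ε) ^ (-α) * n +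
      ⟪tgrad M.nu (fun x => (‖x - ξ‖ ^ 2 + ε) ^ (-α)) x, x - ξ⟫ := by
    rw [← hid]; exact tdiv_smul h2.differentiableAt h3.differentiableAt
  rw [h4, inner_tgrad, h2.fderiv]
  have h5 : (‖x - ξ‖ ^ 2 + ε) ^ (-α) = (‖x - ξ‖ ^ 2 + ε) ^ (-α - 1) * (‖x - ξ‖ ^ 2 + ε) := by
    rw [← Real.rpow_add_one hq.ne']; congr 1; ring
  rw [h5]
  have hp : 0 < (‖x - ξ‖ ^ 2 + ε) ^ (-α - 1) := Real.rpow_pos_of_pos hq _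
  generalize (‖x - ξ‖ ^ 2 + ε) ^ (-α - 1) = w at *
  simp only [smul_apply, innerSL_apply_apply, smul_eq_mul, real_inner_self_eq_norm_sq]
  rw [real_inner_comm (x - ξ) (M.nu x)]
  generalize ⟪x - ξ, M.nu x⟫ = t
  simp only [nsmul_eq_mul, Nat.cast_ofNat]
  have : 0 ≤ α * w * t ^ 2 := by positivity
  nlinarith

theorem tgrad_comp {ν : Eu n → Eu n} {φ : Eu n → ℝ} {x : Eu n} {f : ℝ → ℝ} {f' : ℝ}
    (hφ : DifferentiableAt ℝ φ x) (hf : HasDerivAt f f' (φ x)) :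
    tgrad ν (fun y => f (φ y)) x = f' • tgrad ν φ x := by
  have h : HasFDerivAt (fun y => f (φ y)) (f' • fderiv ℝ φ x) x :=
    hf.comp_hasFDerivAt x hφ.hasFDerivAt
  apply ext_inner_right ℝ
  intro v
  rw [inner_smul_left, inner_tgrad, inner_tgrad, h.fderiv]
  simp; ring

/-- the Dirichlet energy density -/
def dd (M : Hypersurface n) (φ : Eu n → ℝ) (x : Eu n) : ℝ :=
  ‖tgrad M.nu φ x‖ ^ 2 + (meanCurv M x * φ x) ^ 2

theorem dd_nonneg (M : Hypersurface n) (φ : Eu n → ℝ) (x : Eu n) : 0 ≤ dd M φ x := by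
  unfold dd; positivity

theorem dd_integrable (M : Hypersurface n) {K : Set (Eu n)} (hK : IsCompact K)
    (hKM : K ⊆ M.carrier) {φ : Eu n → ℝ} (hφ : ContDiff ℝ 1 φ) (h0 : ∀ x ∈ M.carrier, x ∉ K → φ x = 0) :
    Integrable (dd M φ) (surfMeasure M) := by
  apply integrable_M M hK hKM
  · have h1 := continuous_tgrad M hφ
    have h2 := continuous_meanCurv M
    have h3 := hφ.continuous
    unfold dd; fun_prop
  · intro x hx hxK
    simp [dd, tgrad_zero_off M hK hφ h0 x hx hxK, h0 x hx hxK]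

theorem hardy_eps (hn : 3 ≤ n) (M : Hypersurface n) {K : Set (Eu n)} (hK : IsCompact K)
    (hKM : K ⊆ M.carrier) {φ : Eu n → ℝ} (hφ : ContDiff ℝ 1 φ) (h0 : ∀ x ∈ M.carrier, x ∉ K → φ x = 0)
    {ε : ℝ} (hε : 0 < ε) :
    ∫ x, φ x ^ 2 / (‖x‖ ^ 2 + ε) ∂surfMeasure M ≤ 8 * ∫ x, dd M φ x ∂surfMeasure M := by
  have hA : Adm M K (fun x => φ x ^ 2) := ⟨hK, hKM, hφ.pow 2, fun x => sq_nonneg _,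
    fun x hx hxK => by simp [h0 x hx hxK]⟩
  have hk := hA.key (rad_smooth 0 hε 1)
  have cν := (contDiff_nu M).continuous
  have hn' : (3 : ℝ) ≤ n := by exact_mod_cast hn
  have hq : ∀ x : Eu n, 0 < ‖x‖ ^ 2 + ε := fun x => by positivity
  have iA : Integrable (fun x => φ x ^ 2 / (‖x‖ ^ 2 + ε)) (surfMeasure M) := by
    apply integrable_M M hK hKM
    · have := hφ.continuous
      exact (this.pow 2).div (by fun_prop) (fun x => (hq x).ne')
    · intro x hx hxK; simp [h0 x hx hxK]
  have iD := dd_integrable M hK hKM hφ h0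
  have l1 : ∫ x, φ x ^ 2 / (‖x‖ ^ 2 + ε) ∂surfMeasure M ≤
      ∫ x, φ x ^ 2 * tdiv M.nu (rad 0 ε 1) x ∂surfMeasure M := by
    apply integral_mono_ae iA (hA.int_mul (Frame.continuous_tdiv cν (rad_smooth 0 hε 1)))
    filter_upwards [ae_mem M] with x hx
    have h1 := rad_tdiv M 0 hε (α := 1) (by norm_num) hx
    rw [sub_zero] at h1
    have h2 : (‖x‖ ^ 2 + ε)⁻¹ ≤ tdiv M.nu (rad 0 ε 1) x := by
      refine le_trans ?_ h1
      rw [show (-1 - 1 : ℝ) = ((-2 : ℤ) : ℝ) by norm_num, Real.rpow_intCast]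
      rw [show ((-2 : ℤ)) = -((2 : ℕ) : ℤ) by norm_num, zpow_neg, zpow_natCast]
      have := hq x
      rw [inv_mul_eq_div, inv_eq_one_div, div_le_div_iff₀ this (by positivity)]
      have h3 : 0 ≤ ‖x‖ ^ 2 := by positivity
      nlinarith
    change φ x ^ 2 / (‖x‖ ^ 2 + ε) ≤ φ x ^ 2 * tdiv M.nu (rad 0 ε 1) x
    rw [div_eq_mul_inv]
    exact mul_le_mul_of_nonneg_left h2 (sq_nonneg _)
  have l2 : ∫ x, hh M (fun x => φ x ^ 2) x * ‖rad 0 ε 1 x‖ ∂surfMeasure M ≤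
      ∫ x, (1 / 2) * (φ x ^ 2 / (‖x‖ ^ 2 + ε)) + 4 * dd M φ x ∂surfMeasure M := by
    apply integral_mono_ae (hA.int_hh_mul (rad_smooth 0 hε 1).continuous.norm)
      ((iA.const_mul _).add (iD.const_mul _))
    filter_upwards [ae_mem M] with x hx
    have hg : tgrad M.nu (fun x => φ x ^ 2) x = (2 * φ x) • tgrad M.nu φ x := by
      apply tgrad_comp (f := fun t => t ^ 2) (hφ.differentiable (by norm_num) x)
      simpa using hasDerivAt_pow 2 (φ x)
    have hr : ‖rad 0 ε 1 x‖ = ‖x‖ / (‖x‖ ^ 2 + ε) := by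
      rw [rad, sub_zero, norm_smul, Real.rpow_neg_one, Real.norm_of_nonneg (inv_nonneg.2 (hq x).le)]
      field_simp
    change hh M (fun x => φ x ^ 2) x * ‖rad 0 ε 1 x‖ ≤ (1 / 2) * (φ x ^ 2 / (‖x‖ ^ 2 + ε)) + 4 * dd M φ x
    rw [hr, hh, hg, norm_smul, dd]
    simp only [norm_mul, Real.norm_eq_abs, abs_two]
    have hs : φ x ^ 2 = |φ x| ^ 2 := (sq_abs _).symm
    have hs2 : (meanCurv M x * φ x) ^ 2 = (|meanCurv M x| * |φ x|) ^ 2 := by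
      rw [mul_pow, mul_pow, sq_abs, sq_abs]
    rw [hs, hs2]
    have hG0 : 0 ≤ ‖tgrad M.nu φ x‖ := norm_nonneg _
    have hf0 := abs_nonneg (φ x)
    have hH0 := abs_nonneg (meanCurv M x)
    have hr0 := norm_nonneg x
    have hqx := hq x
    generalize ‖tgrad M.nu φ x‖ = G at *
    generalize |φ x| = f at *
    generalize |meanCurv M x| = H at *
    have hr2 : ‖x‖ ^ 2 ≤ ‖x‖ ^ 2 + ε := by linarith
    generalize ‖x‖ ^ 2 + ε = q at *
    generalize ‖x‖ = r at *
    -- a = f r / q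
    have ha : (f * r / q) ^ 2 ≤ f ^ 2 / q := by
      rw [div_pow, div_le_div_iff₀ (by positivity) hqx, mul_pow]
      have : f ^ 2 * r ^ 2 * q ≤ f ^ 2 * q * q := by
        have : 0 ≤ f ^ 2 * q := by positivity
        nlinarith
      nlinarith
    have e : (2 * f * G + H * f ^ 2) * (r / q) = 2 * (f * r / q) * G + (f * r / q) * (H * f) := by ring
    rw [e]
    generalize f * r / q = a at *
    nlinarith [sq_nonneg (a / 2 - 2 * G), sq_nonneg (a / 2 - H * f), sq_nonneg (H * f)]
  rw [integral_add (iA.const_mul _) (iD.const_mul _), integral_const_mul, integral_const_mul] at l2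
  linarith

theorem hardy (hn : 3 ≤ n) (M : Hypersurface n) {K : Set (Eu n)} (hK : IsCompact K)
    (hKM : K ⊆ M.carrier) {φ : Eu n → ℝ} (hφ : ContDiff ℝ 1 φ) (h0 : ∀ x ∈ M.carrier, x ∉ K → φ x = 0) :
    ∫⁻ x, ENNReal.ofReal (φ x ^ 2 / ‖x‖ ^ 2) ∂surfMeasure M ≤
      ENNReal.ofReal (8 * ∫ x, dd M φ x ∂surfMeasure M) := by
  let ε : ℕ → ℝ := fun k => 1 / ((k : ℝ) + 1)
  have hε : ∀ k, 0 < ε k := fun k => Nat.one_div_pos_of_nat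
  have hεt : Tendsto ε atTop (𝓝 0) := tendsto_one_div_add_atTop_nhds_zero_nat
  have hc := hφ.continuous
  have hcont : ∀ k, Continuous (fun x : Eu n => φ x ^ 2 / (‖x‖ ^ 2 + ε k)) := fun k =>
    (hc.pow 2).div (by fun_prop) (fun x => by have := hε k; positivity)
  calc ∫⁻ x, ENNReal.ofReal (φ x ^ 2 / ‖x‖ ^ 2) ∂surfMeasure M
      ≤ ∫⁻ x, liminf (fun k => ENNReal.ofReal (φ x ^ 2 / (‖x‖ ^ 2 + ε k))) atTop ∂surfMeasure M := by
        apply lintegral_mono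
        intro x
        by_cases hx : x = 0
        · simp [hx]
        · have hx' : ‖x‖ ^ 2 ≠ 0 := by positivity
          have : Tendsto (fun k => ENNReal.ofReal (φ x ^ 2 / (‖x‖ ^ 2 + ε k))) atTop
              (𝓝 (ENNReal.ofReal (φ x ^ 2 / (‖x‖ ^ 2 + 0)))) := by
            apply ENNReal.tendsto_ofReal
            apply Tendsto.div tendsto_const_nhds (tendsto_const_nhds.add hεt)
            simpa using hx
          rw [add_zero] at this
          exact this.liminf_eq.ge
    _ ≤ liminf (fun k => ∫⁻ x, ENNReal.ofReal (φ x ^ 2 / (‖x‖ ^ 2 + ε k)) ∂surfMeasure M) atTop := by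
        apply lintegral_liminf_le
        intro k
        exact ENNReal.measurable_ofReal.comp (hcont k).measurable
    _ ≤ _ := by
        apply liminf_le_of_frequently_le'
        apply Frequently.of_forall
        intro k
        rw [← ofReal_integral_eq_lintegral_ofReal]
        · exact ENNReal.ofReal_le_ofReal (hardy_eps hn M hK hKM hφ h0 (hε k))
        · apply integrable_M M hK hKM (hcont k)
          intro x hx hxK; simp [h0 x hx hxK]
        · filter_upwards with x
          have := hε k
          positivity

/-- constant -/
def c1 (n : ℕ) : ℝ := n / 2 ^ ((n : ℝ) / 2 + 1)

theorem c1_pos (hn : 1 ≤ n) : 0 < c1 n := by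
  have : (0 : ℝ) < n := by exact_mod_cast hn
  unfold c1; positivity

theorem rpow_sq_half {a : ℝ} (ha : 0 ≤ a) (n : ℕ) : (a ^ 2) ^ ((n : ℝ) / 2) = a ^ n := by
  rw [← Real.rpow_natCast a 2, ← Real.rpow_mul ha, ← Real.rpow_natCast a n]
  congr 1; push_cast; ring

namespace Adm
variable {M : Hypersurface n} {K : Set (Eu n)} {u : Eu n → ℝ}

theorem mono1 (h : Adm M K u) (hn : 1 ≤ n) (ξ : Eu n) {s : ℝ} (hs : 0 < s) :
    c1 n * ∫ x in closedBall ξ s, u x ∂surfMeasure M ≤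
      s ^ n * ∫ x, hh M u x * (max ‖x - ξ‖ s ^ (n - 1))⁻¹ ∂surfMeasure M := by
  have hs2 : 0 < s ^ 2 := by positivity
  have hY := rad_smooth ξ hs2 ((n : ℝ) / 2)
  have hk := h.key hY
  have cν := (contDiff_nu M).continuous
  have iT := h.int_mul (Frame.continuous_tdiv cν hY)
  have hm : ∀ x : Eu n, 0 < max ‖x - ξ‖ s := fun x => lt_max_of_lt_right hs
  have cJ : Continuous (fun x : Eu n => (max ‖x - ξ‖ s ^ (n - 1))⁻¹) :=
    Continuous.inv₀ (by fun_prop) (fun x => (pow_pos (hm x) _).ne')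
  have r1 : ∫ x, hh M u x * ‖rad ξ (s ^ 2) ((n : ℝ) / 2) x‖ ∂surfMeasure M ≤
      ∫ x, hh M u x * (max ‖x - ξ‖ s ^ (n - 1))⁻¹ ∂surfMeasure M := by
    apply integral_mono (h.int_hh_mul hY.continuous.norm) (h.int_hh_mul cJ)
    intro x
    apply mul_le_mul_of_nonneg_left _ (h.hh_nonneg x)
    have hq : 0 < ‖x - ξ‖ ^ 2 + s ^ 2 := by positivity
    rw [rad, norm_smul, Real.norm_of_nonneg (Real.rpow_nonneg hq.le _), Real.rpow_neg hq.le]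
    have hqm : max ‖x - ξ‖ s ^ n ≤ (‖x - ξ‖ ^ 2 + s ^ 2) ^ ((n : ℝ) / 2) := by
      rw [← rpow_sq_half (hm x).le]
      apply Real.rpow_le_rpow (by positivity) _ (by positivity)
      rcases max_choice ‖x - ξ‖ s with h1 | h1 <;> rw [h1] <;> nlinarith [sq_nonneg ‖x - ξ‖, sq_nonneg s]
    have hpm := pow_pos (hm x) n
    calc ((‖x - ξ‖ ^ 2 + s ^ 2) ^ ((n : ℝ) / 2))⁻¹ * ‖x - ξ‖ ≤ (max ‖x - ξ‖ s ^ n)⁻¹ * max ‖x - ξ‖ s := by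
          gcongr
          exact le_max_left _ _
      _ = _ := by
          obtain ⟨m, rfl⟩ : ∃ m, n = m + 1 := ⟨n - 1, by omega⟩
          have := hm x
          rw [Nat.add_sub_cancel, pow_succ]
          field_simp
  set κ : ℝ := (2 * s ^ 2) ^ (-((n : ℝ) / 2) - 1) * (n * s ^ 2) with hκ
  have hlow : ∀ x ∈ M.carrier, 0 ≤ tdiv M.nu (rad ξ (s ^ 2) ((n : ℝ) / 2)) x ∧
      (x ∈ closedBall ξ s → κ ≤ tdiv M.nu (rad ξ (s ^ 2) ((n : ℝ) / 2)) x) := by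
    intro x hx
    have h1 := rad_tdiv M ξ hs2 (α := (n : ℝ) / 2) (by positivity) hx
    rw [show ((n : ℝ) - 2 * (n / 2)) = 0 by ring, zero_mul, zero_add] at h1
    refine ⟨le_trans (by positivity) h1, fun hxb => le_trans ?_ h1⟩
    rw [hκ]
    apply mul_le_mul_of_nonneg_right _ (by positivity)
    apply Real.rpow_le_rpow_of_nonpos (by positivity)
    · rw [mem_closedBall, dist_eq_norm] at hxb
      have := pow_le_pow_left₀ (norm_nonneg _) hxb 2
      linarith
    · have : (0 : ℝ) ≤ n := by positivity
      linarith
  have l1 : κ * ∫ x in closedBall ξ s, u x ∂surfMeasure M ≤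
      ∫ x, u x * tdiv M.nu (rad ξ (s ^ 2) ((n : ℝ) / 2)) x ∂surfMeasure M := by
    rw [← integral_const_mul]
    calc ∫ x in closedBall ξ s, κ * u x ∂surfMeasure M
        ≤ ∫ x in closedBall ξ s, u x * tdiv M.nu (rad ξ (s ^ 2) ((n : ℝ) / 2)) x ∂surfMeasure M := by
          apply setIntegral_mono_on_ae (h.int_u.const_mul _).integrableOn iT.integrableOn
            isClosed_closedBall.measurableSet
          filter_upwards [ae_mem M] with x hx hxb
          rw [mul_comm]
          exact mul_le_mul_of_nonneg_left ((hlow x hx).2 hxb) (h.nonneg x)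
      _ ≤ _ := by
          apply setIntegral_le_integral iT
          filter_upwards [ae_mem M] with x hx
          exact mul_nonneg (h.nonneg x) (hlow x hx).1
  have hκ2 : s ^ n * κ = c1 n := by
    rw [hκ, c1, show -((n : ℝ) / 2) - 1 = -((n : ℝ) / 2 + 1) by ring, Real.rpow_neg (by positivity),
      Real.mul_rpow (by norm_num) (by positivity), Real.rpow_add (x := s ^ 2) (by positivity), rpow_sq_half hs.le,
      Real.rpow_one]
    field_simp
  rw [← hκ2, mul_assoc]
  exact mul_le_mul_of_nonneg_left (l1.trans (hk.trans r1)) (by positivity)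

/-- existence of good radii -/
theorem good_radius (h : Adm M K u) (hn : 1 ≤ n) {ξ : Eu n} (hξ : ξ ∈ M.carrier) (hu : 1 ≤ u ξ)
    {ρ0 : ℝ} (hρ0 : 0 < ρ0)
    (hE : 4 * ∫ x, hh M u x ∂surfMeasure M < c1 n * c2 n * (ρ0 / 2) ^ (n - 1)) :
    ∃ ρ, 0 < ρ ∧ ρ ≤ ρ0 ∧ c1 n / (2 * 10 ^ n) * ∫ x in closedBall ξ (5 * ρ), u x ∂surfMeasure M
      ≤ ρ0 * ∫ x in closedBall ξ ρ, hh M u x ∂surfMeasure M := by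
  by_contra! hcon
  set E := ∫ x, hh M u x ∂surfMeasure M with hEd
  have hE0 : 0 ≤ E := integral_nonneg h.hh_nonneg
  set ψ : ℝ → ℝ := fun s => ∫ x in closedBall ξ s, u x ∂surfMeasure M with hψ
  set J : ℝ → ℝ := fun s => ∫ x, hh M u x * (max ‖x - ξ‖ s ^ (n - 1))⁻¹ ∂surfMeasure M with hJ
  have hc1 := c1_pos hn
  have hc2 := c2_pos (n := n)
  have hψ0 : ∀ s, 0 ≤ ψ s := fun s => integral_nonneg h.nonneg
  have hψI : ∀ s, ψ s ≤ ∫ x, u x ∂surfMeasure M := fun s =>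
    setIntegral_le_integral h.int_u (Eventually.of_forall h.nonneg)
  have hm : ∀ {s : ℝ} (_ : 0 < s) (x : Eu n), 0 < max ‖x - ξ‖ s := fun hs x => lt_max_of_lt_right hs
  have cJ : ∀ {s : ℝ} (_ : 0 < s), Continuous (fun x : Eu n => (max ‖x - ξ‖ s ^ (n - 1))⁻¹) := fun hs =>
    Continuous.inv₀ (by fun_prop) (fun x => (pow_pos (hm hs x) _).ne')
  -- lower density
  obtain ⟨s1, hs1, hden⟩ := density M hξ
  have hcu : ∀ᶠ x in 𝓝 ξ, 1 / 2 < u x :=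
    h.smooth.continuous.continuousAt.eventually (lt_mem_nhds (by linarith))
  obtain ⟨δ, hδ, hδu⟩ := Metric.eventually_nhds_iff_ball.1 hcu
  set s0 := min s1 (δ / 2) with hs0d
  have hs0 : 0 < s0 := by positivity
  have hlow : c2 n / 2 * s0 ^ n ≤ ψ s0 := by
    have d1 := hden s0 hs0 (min_le_left _ _)
    have d2 : ENNReal.ofReal (c2 n / 2 * s0 ^ n) ≤ ENNReal.ofReal (ψ s0) := by
      rw [hψ, ofReal_integral_eq_lintegral_ofReal h.int_u.integrableOn (Eventually.of_forall h.nonneg)]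
      calc ENNReal.ofReal (c2 n / 2 * s0 ^ n)
          = ENNReal.ofReal (1 / 2) * ENNReal.ofReal (c2 n * s0 ^ n) := by
            rw [← ENNReal.ofReal_mul (by norm_num)]; congr 1; ring
        _ ≤ ENNReal.ofReal (1 / 2) * surfMeasure M (closedBall ξ s0) := by gcongr
        _ = ∫⁻ x in closedBall ξ s0, ENNReal.ofReal (1 / 2) ∂surfMeasure M := by
            rw [setLIntegral_const]
        _ ≤ _ := by
            apply setLIntegral_mono_ae' isClosed_closedBall.measurableSet
            filter_upwards with x hx
            apply ENNReal.ofReal_le_ofReal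
            refine (hδu x (closedBall_subset_ball ?_ hx)).le
            exact lt_of_le_of_lt (min_le_right _ _) (by linarith)
    exact (ENNReal.ofReal_le_ofReal_iff (hψ0 s0)).1 d2
  -- supremum
  set A : Set ℝ := (fun s => ψ s / s ^ n) '' Ici s0 with hA
  have hAb : BddAbove A := by
    refine ⟨(∫ x, u x ∂surfMeasure M) / s0 ^ n, ?_⟩
    rintro _ ⟨s, hs, rfl⟩
    have : s0 ≤ s := hs
    have hI : 0 ≤ ∫ x, u x ∂surfMeasure M := integral_nonneg h.nonneg
    exact div_le_div₀ hI (hψI s) (by positivity) (pow_le_pow_left₀ hs0.le this n)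
  have hAn : A.Nonempty := ⟨_, s0, self_mem_Ici, rfl⟩
  set S := sSup A with hS
  have hSle : ∀ s, s0 ≤ s → ψ s ≤ S * s ^ n := by
    intro s hs
    have : ψ s / s ^ n ≤ S := le_csSup hAb ⟨s, hs, rfl⟩
    have hsp : 0 < s := hs0.trans_le hs
    rwa [div_le_iff₀ (by positivity)] at this
  have hSlow : c2 n / 2 ≤ S := by
    have h1 : ψ s0 / s0 ^ n ≤ S := le_csSup hAb ⟨s0, self_mem_Ici, rfl⟩
    refine le_trans ?_ h1
    rwa [le_div_iff₀ (by positivity)]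
  have hS0 : 0 < S := by linarith
  set B := E / (ρ0 / 2) ^ (n - 1) with hB
  have hB0 : 0 ≤ B := by positivity
  have hJbig : ∀ s, ρ0 / 2 ≤ s → J s ≤ B := by
    intro s hs
    have hsp : 0 < s := by linarith
    rw [hB, div_eq_mul_inv, ← integral_mul_const]
    apply integral_mono (h.int_hh_mul (cJ hsp)) (h.int_hh.mul_const _)
    intro x
    apply mul_le_mul_of_nonneg_left _ (h.hh_nonneg x)
    gcongr
    exact hs.trans (le_max_right _ _)
  have hJstep : ∀ s, s0 ≤ s → 2 * s ≤ ρ0 → J s ≤ c1 n / 2 * S / ρ0 * s + J (2 * s) := by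
    intro s hs hsρ
    have hsp : 0 < s := hs0.trans_le hs
    have hf : ρ0 * ∫ x in closedBall ξ (2 * s), hh M u x ∂surfMeasure M ≤
        c1 n / (2 * 10 ^ n) * (S * (5 * (2 * s)) ^ n) := by
      refine (hcon (2 * s) (by linarith) hsρ).le.trans ?_
      apply mul_le_mul_of_nonneg_left (hSle _ (by linarith)) (by positivity)
    have hf2 : ∫ x in closedBall ξ (2 * s), hh M u x ∂surfMeasure M ≤ c1 n / 2 * S / ρ0 * s * s ^ (n - 1) := by
      have e1 : c1 n / (2 * 10 ^ n) * (S * (5 * (2 * s)) ^ n) = ρ0 * (c1 n / 2 * S / ρ0 * s * s ^ (n - 1)) := by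
        have : s ^ n = s * s ^ (n - 1) := by rw [← pow_succ']; congr 1; omega
        rw [show 5 * (2 * s) = 10 * s by ring, mul_pow, this]
        field_simp
      rw [e1] at hf
      exact le_of_mul_le_mul_left hf hρ0
    have hpt : J s ≤ ∫ x, ((closedBall ξ (2 * s)).indicator (fun x => hh M u x * (s ^ (n - 1))⁻¹) x +
        hh M u x * (max ‖x - ξ‖ (2 * s) ^ (n - 1))⁻¹) ∂surfMeasure M := by
      apply integral_mono (h.int_hh_mul (cJ hsp))
        (((h.int_hh.mul_const _).indicator isClosed_closedBall.measurableSet).add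
          (h.int_hh_mul (cJ (by linarith : 0 < 2 * s))))
      intro x
      have hh0 := h.hh_nonneg x
      by_cases hx : x ∈ closedBall ξ (2 * s)
      · simp only [indicator_of_mem hx, Pi.add_apply]
        have : hh M u x * (max ‖x - ξ‖ s ^ (n - 1))⁻¹ ≤ hh M u x * (s ^ (n - 1))⁻¹ := by
          gcongr
          exact le_max_right _ _
        have h2 : 0 ≤ hh M u x * (max ‖x - ξ‖ (2 * s) ^ (n - 1))⁻¹ := by
          have := hm (by linarith : 0 < 2 * s) x
          positivity
        linarith
      · simp only [indicator_of_notMem hx, Pi.add_apply, zero_add]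
        rw [mem_closedBall, dist_eq_norm, not_le] at hx
        rw [max_eq_left (by linarith), max_eq_left hx.le]
    rw [integral_add ((h.int_hh.mul_const _).indicator isClosed_closedBall.measurableSet)
          (h.int_hh_mul (cJ (by linarith : 0 < 2 * s))),
      integral_indicator isClosed_closedBall.measurableSet, integral_mul_const] at hpt
    refine hpt.trans (add_le_add ?_ le_rfl)
    rw [← div_eq_mul_inv, div_le_iff₀ (by positivity)]
    exact hf2
  have hJind : ∀ m : ℕ, ∀ s, s0 ≤ s → s ≤ ρ0 → ρ0 / 2 ≤ 2 ^ m * s →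
      J s ≤ c1 n / 2 * S / ρ0 * (ρ0 - s) + B := by
    intro m
    induction m with
    | zero =>
      intro s hs hsρ h2
      have := hJbig s (by simpa using h2)
      have : 0 ≤ c1 n / 2 * S / ρ0 * (ρ0 - s) := mul_nonneg (by positivity) (by linarith)
      linarith
    | succ m ih =>
      intro s hs hsρ h2
      by_cases hc : ρ0 / 2 ≤ s
      · have := hJbig s hc
        have : 0 ≤ c1 n / 2 * S / ρ0 * (ρ0 - s) := mul_nonneg (by positivity) (by linarith)
        linarith
      · have h3 := hJstep s hs (by linarith)
        have h4 := ih (2 * s) (by linarith) (by linarith) (by rw [pow_succ] at h2; linarith)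
        nlinarith
  have hJall : ∀ s, s0 ≤ s → J s ≤ c1 n / 2 * S + B := by
    intro s hs
    have hsp : 0 < s := hs0.trans_le hs
    by_cases hc : ρ0 / 2 ≤ s
    · have := hJbig s hc
      have : 0 ≤ c1 n / 2 * S := by positivity
      linarith
    · obtain ⟨m, hm⟩ := pow_unbounded_of_one_lt (ρ0 / 2 / s) (by norm_num : (1 : ℝ) < 2)
      rw [div_lt_iff₀ hsp] at hm
      refine (hJind m s hs (by linarith) hm.le).trans ?_
      have : c1 n / 2 * S / ρ0 * (ρ0 - s) ≤ c1 n / 2 * S / ρ0 * ρ0 :=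
        mul_le_mul_of_nonneg_left (by linarith) (by positivity)
      rw [div_mul_cancel₀ _ hρ0.ne'] at this
      linarith
  have hfin : S ≤ (c1 n / 2 * S + B) / c1 n := by
    apply csSup_le hAn
    rintro _ ⟨s, hs, rfl⟩
    have hsp : 0 < s := hs0.trans_le hs
    have h1 := h.mono1 hn ξ hsp
    have h2 := hJall s hs
    rw [div_le_div_iff₀ (by positivity) hc1]
    have h3 : s ^ n * J s ≤ s ^ n * (c1 n / 2 * S + B) := mul_le_mul_of_nonneg_left h2 (by positivity)
    have h1' : c1 n * ψ s ≤ s ^ n * J s := h1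
    linarith
  rw [le_div_iff₀ hc1] at hfin
  have hBlt : 4 * B < c1 n * c2 n := by
    rw [hB, ← mul_div_assoc, div_lt_iff₀ (by positivity)]
    exact hE
  nlinarith

end Adm

namespace Adm
variable {M : Hypersurface n} {K : Set (Eu n)} {u : Eu n → ℝ}

theorem weak1 (h : Adm M K u) (hn : 1 ≤ n) {ρ0 : ℝ} (hρ0 : 0 < ρ0)
    (hE : 4 * ∫ x, hh M u x ∂surfMeasure M < c1 n * c2 n * (ρ0 / 2) ^ (n - 1)) :
    surfMeasure M {x | 1 ≤ u x} ≤
      ENNReal.ofReal (ρ0 / (c1 n / (2 * 10 ^ n)) * ∫ x, hh M u x ∂surfMeasure M) := by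
  have hδ : 0 < c1 n / (2 * 10 ^ n) := by have := c1_pos hn; positivity
  set δ := c1 n / (2 * 10 ^ n) with hδdef
  set t : Set (Eu n) := {x | x ∈ M.carrier ∧ 1 ≤ u x} with ht
  have hg : ∀ ξ : Eu n, ∃ ρ : ℝ, ξ ∈ t → 0 < ρ ∧ ρ ≤ ρ0 ∧
      δ * ∫ x in closedBall ξ (5 * ρ), u x ∂surfMeasure M ≤
        ρ0 * ∫ x in closedBall ξ ρ, hh M u x ∂surfMeasure M := by
    intro ξ
    by_cases hξ : ξ ∈ t
    · obtain ⟨ρ, h1, h2, h3⟩ := h.good_radius hn hξ.1 hξ.2 hρ0 hE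
      exact ⟨ρ, fun _ => ⟨h1, h2, h3⟩⟩
    · exact ⟨0, fun hh => absurd hh hξ⟩
  choose ρ hρ using hg
  obtain ⟨w, hwt, hdisj, hcov⟩ := Vitali.exists_disjoint_subfamily_covering_enlargement_closedBall t
    (fun x => x) ρ ρ0 (fun a ha => (hρ a ha).2.1) 5 (by norm_num)
  have hwc : w.Countable := hdisj.countable_of_nonempty_interior (fun i hi =>
    ⟨i, ball_subset_interior_closedBall (mem_ball_self (hρ i (hwt hi)).1)⟩)
  have hm : MeasurableSet {x | 1 ≤ u x} := measurableSet_le measurable_const h.smooth.continuous.measurable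
  have hball : ∀ ξ ∈ w, surfMeasure M ({x | 1 ≤ u x} ∩ closedBall ξ (5 * ρ ξ)) ≤
      ENNReal.ofReal (ρ0 / δ) * ∫⁻ x in closedBall ξ (ρ ξ), ENNReal.ofReal (hh M u x) ∂surfMeasure M := by
    intro ξ hξ
    have h3 := (hρ ξ (hwt hξ)).2.2
    calc surfMeasure M ({x | 1 ≤ u x} ∩ closedBall ξ (5 * ρ ξ))
        = (surfMeasure M).restrict (closedBall ξ (5 * ρ ξ)) {x | 1 ≤ u x} := by
          rw [Measure.restrict_apply hm]
      _ ≤ (surfMeasure M).restrict (closedBall ξ (5 * ρ ξ)) {x | 1 ≤ ENNReal.ofReal (u x)} := by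
          apply measure_mono
          intro x hx
          simpa using ENNReal.ofReal_le_ofReal (show (1:ℝ) ≤ u x from hx)
      _ ≤ ∫⁻ x in closedBall ξ (5 * ρ ξ), ENNReal.ofReal (u x) ∂surfMeasure M := by
          have := mul_meas_ge_le_lintegral (μ := (surfMeasure M).restrict (closedBall ξ (5 * ρ ξ)))
            (f := fun x => ENNReal.ofReal (u x)) h.smooth.continuous.measurable.ennreal_ofReal 1
          simpa using this
      _ = ENNReal.ofReal (∫ x in closedBall ξ (5 * ρ ξ), u x ∂surfMeasure M) :=
          (ofReal_integral_eq_lintegral_ofReal h.int_u.integrableOn (Eventually.of_forall h.nonneg)).symm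
      _ ≤ ENNReal.ofReal (ρ0 / δ * ∫ x in closedBall ξ (ρ ξ), hh M u x ∂surfMeasure M) := by
          apply ENNReal.ofReal_le_ofReal
          rw [div_mul_eq_mul_div, le_div_iff₀ hδ, mul_comm]; exact h3
      _ = _ := by
          rw [ENNReal.ofReal_mul (by positivity),
            ofReal_integral_eq_lintegral_ofReal h.int_hh.integrableOn (Eventually.of_forall h.hh_nonneg)]
  have hsub : {x | 1 ≤ u x} ∩ M.carrier ⊆ ⋃ ξ ∈ w, ({x | 1 ≤ u x} ∩ closedBall ξ (5 * ρ ξ)) := by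
    intro x hx
    obtain ⟨b, hb, hbb⟩ := hcov x ⟨hx.2, hx.1⟩
    refine mem_biUnion hb ⟨hx.1, hbb (mem_closedBall_self (hρ x ⟨hx.2, hx.1⟩).1.le)⟩
  have hae : surfMeasure M {x | 1 ≤ u x} ≤ surfMeasure M ({x | 1 ≤ u x} ∩ M.carrier) := by
    apply measure_mono_ae
    filter_upwards [ae_mem M] with x hx hx1 using ⟨hx1, hx⟩
  calc surfMeasure M {x | 1 ≤ u x} ≤ _ := hae.trans (measure_mono hsub)
    _ ≤ ∑' ξ : w, surfMeasure M ({x | 1 ≤ u x} ∩ closedBall (ξ : Eu n) (5 * ρ ξ)) := measure_biUnion_le _ hwc _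
    _ ≤ ∑' ξ : w, ENNReal.ofReal (ρ0 / δ) * ∫⁻ x in closedBall (ξ : Eu n) (ρ ξ), ENNReal.ofReal (hh M u x) ∂surfMeasure M :=
        ENNReal.tsum_le_tsum fun ξ => hball ξ ξ.2
    _ = ENNReal.ofReal (ρ0 / δ) * ∫⁻ x in ⋃ ξ ∈ w, closedBall (ξ : Eu n) (ρ ξ), ENNReal.ofReal (hh M u x) ∂surfMeasure M := by
        rw [ENNReal.tsum_mul_left, lintegral_biUnion hwc (fun _ _ => isClosed_closedBall.measurableSet) hdisj]
    _ ≤ ENNReal.ofReal (ρ0 / δ) * ∫⁻ x, ENNReal.ofReal (hh M u x) ∂surfMeasure M := by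
        gcongr
        exact Measure.restrict_le_self
    _ = _ := by
        rw [ENNReal.ofReal_mul (by positivity),
            ofReal_integral_eq_lintegral_ofReal h.int_hh (Eventually.of_forall h.hh_nonneg)]
end Adm

def cw (n : ℕ) : ℝ := 2 / (c1 n / (2 * 10 ^ n)) * (8 / (c1 n * c2 n)) ^ ((1 : ℝ) / (n - 1))

theorem cw_nonneg (hn : 2 ≤ n) : 0 ≤ cw n := by
  have := c1_pos (n := n) (by omega)
  have := c2_pos (n := n)
  unfold cw; positivity

theorem Adm.weak {M : Hypersurface n} {K : Set (Eu n)} {u : Eu n → ℝ} (h : Adm M K u) (hn : 2 ≤ n) :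
    surfMeasure M {x | 1 ≤ u x} ≤
      ENNReal.ofReal (cw n) * (∫⁻ x, ENNReal.ofReal (hh M u x) ∂surfMeasure M) ^ ((n : ℝ) / (n - 1)) := by
  have k1 := c1_pos (n := n) (by omega)
  have k2 := c2_pos (n := n)
  have hn' : (2 : ℝ) ≤ n := by exact_mod_cast hn
  rw [← ofReal_integral_eq_lintegral_ofReal h.int_hh (Eventually.of_forall h.hh_nonneg)]
  have hE0 : 0 ≤ ∫ x, hh M u x ∂surfMeasure M := integral_nonneg h.hh_nonneg
  have hw := fun {ρ0 : ℝ} => h.weak1 (by omega) (ρ0 := ρ0)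
  set E := ∫ x, hh M u x ∂surfMeasure M with hE
  rw [ENNReal.ofReal_rpow_of_nonneg hE0 (div_nonneg (by linarith) (by linarith)), ← ENNReal.ofReal_mul (cw_nonneg hn)]
  rcases hE0.eq_or_lt with h0 | h0
  · have := hw one_pos (by rw [← h0]; simp; positivity)
    rw [← h0] at this ⊢
    refine this.trans ?_
    simp
  · set X := 8 / (c1 n * c2 n) with hX
    have hX0 : 0 < X := by positivity
    have hpow : ((X * E) ^ ((1 : ℝ) / (n - 1))) ^ (n - 1) = X * E := by
      rw [← Real.rpow_natCast, ← Real.rpow_mul (by positivity), Nat.cast_sub (by omega), Nat.cast_one,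
        one_div_mul_cancel (by linarith), Real.rpow_one]
    have := hw (ρ0 := 2 * (X * E) ^ ((1 : ℝ) / (n - 1))) (by positivity) (by
      rw [mul_div_cancel_left₀ _ (by norm_num : (2:ℝ) ≠ 0), hpow, hX]
      field_simp
      linarith)
    refine this.trans (le_of_eq ?_)
    congr 1
    have e : (n : ℝ) / (n - 1) = 1 / (n - 1) + 1 := by
      have : (n : ℝ) - 1 ≠ 0 := by linarith
      field_simp
      ring
    rw [e, Real.rpow_add_one h0.ne', cw, ← hX, Real.mul_rpow hX0.le h0.le]
    ring

def TT (t : ℝ) : ℝ := Real.smoothTransition (t - 1)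

theorem TT_smooth : ContDiff ℝ 1 TT :=
  (Real.smoothTransition.contDiff (n := 1)).comp (contDiff_id.sub contDiff_const)

theorem TT_zero {t : ℝ} (ht : t ≤ 1) : TT t = 0 := Real.smoothTransition.zero_of_nonpos (by linarith)
theorem TT_one {t : ℝ} (ht : 2 ≤ t) : TT t = 1 := Real.smoothTransition.one_of_one_le (by linarith)
theorem TT_nonneg (t : ℝ) : 0 ≤ TT t := Real.smoothTransition.nonneg _
theorem TT_le_one (t : ℝ) : TT t ≤ 1 := Real.smoothTransition.le_one _

theorem TT_deriv_lt {t : ℝ} (ht : t < 1) : deriv TT t = 0 := by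
  have : TT =ᶠ[𝓝 t] fun _ => 0 := by
    filter_upwards [Iio_mem_nhds ht] with s hs using TT_zero (le_of_lt hs)
  rw [this.deriv_eq]; simp

theorem TT_deriv_gt {t : ℝ} (ht : 2 < t) : deriv TT t = 0 := by
  have : TT =ᶠ[𝓝 t] fun _ => 1 := by
    filter_upwards [Ioi_mem_nhds ht] with s hs using TT_one (le_of_lt hs)
  rw [this.deriv_eq]; simp

theorem TT_deriv_bound : ∃ B : ℝ, 0 < B ∧ ∀ t, |deriv TT t| ≤ B := by
  have hc : Continuous (deriv TT) := TT_smooth.continuous_deriv (by norm_num)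
  obtain ⟨B, hB⟩ := (isCompact_Icc (a := (1:ℝ)) (b := 2)).exists_bound_of_continuousOn hc.continuousOn
  refine ⟨max B 1, by positivity, fun t => ?_⟩
  by_cases h1 : t < 1
  · rw [TT_deriv_lt h1]; simp
  by_cases h2 : 2 < t
  · rw [TT_deriv_gt h2]; simp
  exact (hB t ⟨not_lt.1 h1, not_lt.1 h2⟩).trans (le_max_left _ _)

def cL : ℝ := TT_deriv_bound.choose
theorem cL_pos : 0 < cL := TT_deriv_bound.choose_spec.1
theorem cL_bound (t : ℝ) : |deriv TT t| ≤ cL := TT_deriv_bound.choose_spec.2 t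

theorem geo_sum (m : ℤ) : ∑' k : ℤ, ENNReal.ofReal (if k ≤ m then (2:ℝ) ^ (k - m) else 0) = 2 := by
  rw [← (Equiv.addLeft m).tsum_eq, tsum_of_nat_of_neg_add_one ENNReal.summable ENNReal.summable,
    tsum_eq_single 0]
  · have : ∀ i : ℕ, ENNReal.ofReal (if (Equiv.addLeft m) (-((i:ℤ) + 1)) ≤ m then
        (2:ℝ) ^ ((Equiv.addLeft m) (-((i:ℤ) + 1)) - m) else 0) = (2 : ℝ≥0∞)⁻¹ ^ (i + 1) := by
      intro i
      rw [if_pos (by rw [Equiv.coe_addLeft]; show m + -((i:ℤ) + 1) ≤ m; omega), Equiv.coe_addLeft, add_sub_cancel_left, zpow_neg, ← inv_zpow,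
        show ((i:ℤ) + 1) = ((i + 1 : ℕ) : ℤ) by simp, zpow_natCast, ENNReal.ofReal_pow (by norm_num),
        ENNReal.ofReal_inv_of_pos (by norm_num)]
      simp
    simp only [this, ENNReal.tsum_geometric_add_one]
    simp [ENNReal.one_sub_inv_two, ENNReal.inv_mul_cancel, one_add_one_eq_two]
  · intro i hi
    rw [if_neg (by rw [Equiv.coe_addLeft]; show ¬ (m + (i:ℤ) ≤ m); omega)]; simp

theorem tsum_rpow_le {ι : Type*} (a : ι → ℝ≥0∞) {p : ℝ} (hp : 1 ≤ p) : ∑' i, a i ^ p ≤ (∑' i, a i) ^ p := by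
  have e : ∀ x : ℝ≥0∞, x ^ p = x * x ^ (p - 1) := by
    intro x
    conv_lhs => rw [show p = 1 + (p - 1) by ring, ENNReal.rpow_add_of_nonneg _ _ zero_le_one (by linarith), ENNReal.rpow_one]
  rw [e, ← ENNReal.tsum_mul_right]
  refine ENNReal.tsum_le_tsum fun i => ?_
  rw [e]
  gcongr
  exact ENNReal.le_tsum i

theorem Adm.trunc {M : Hypersurface n} {K : Set (Eu n)} {u : Eu n → ℝ} (h : Adm M K u) {c : ℝ} (_ : 0 ≤ c) :
    Adm M K (fun x => TT (c * u x)) where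
  cpt := h.cpt
  sub := h.sub
  smooth := TT_smooth.comp (contDiff_const.mul h.smooth)
  nonneg x := TT_nonneg _
  zero x hx hxK := by rw [h.zero x hx hxK]; exact TT_zero (by simp)

theorem Adm.hh_trunc {M : Hypersurface n} {K : Set (Eu n)} {u : Eu n → ℝ} (h : Adm M K u) (x : Eu n) (m k : ℤ)
    (hm : u x < 2 ^ (m + 1)) (hm2 : 2 ^ m ≤ u x) :
    2 ^ k * hh M (fun x => TT ((2 ^ k)⁻¹ * u x)) x ≤ (if k ≤ m then (2:ℝ) ^ (k - m) else 0) * ((2 * cL + 1) * hh M u x) := by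
  have hLp := cL_pos
  have hk : (0:ℝ) < 2 ^ k := by positivity
  have ht := tgrad_comp (ν := M.nu) (φ := u) (f := fun t => TT ((2 ^ k)⁻¹ * t)) (f' := (2 ^ k)⁻¹ * deriv TT ((2 ^ k)⁻¹ * u x)) (x := x)
    (h.smooth.differentiable (by norm_num) x) (by
      have h1 := (TT_smooth.differentiable (by norm_num) ((2 ^ k)⁻¹ * u x)).hasDerivAt
      have h2 : HasDerivAt (fun t : ℝ => ((2:ℝ) ^ k)⁻¹ * t) ((2 ^ k)⁻¹) (u x) := by
        simpa using (hasDerivAt_id (u x)).const_mul ((2:ℝ) ^ k)⁻¹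
      have := h1.comp (u x) h2
      rw [mul_comm]; exact this)
  have e : 2 ^ k * hh M (fun x => TT ((2 ^ k)⁻¹ * u x)) x =
      |deriv TT ((2 ^ k)⁻¹ * u x)| * ‖tgrad M.nu u x‖ + 2 ^ k * TT ((2 ^ k)⁻¹ * u x) * |meanCurv M x| := by
    unfold hh
    rw [ht, norm_smul, Real.norm_eq_abs, abs_mul, abs_of_pos (inv_pos.2 hk)]
    field_simp
  rw [e]
  split_ifs with hkm
  · have b1 : |deriv TT ((2 ^ k)⁻¹ * u x)| ≤ 2 ^ (k - m) * (2 * cL) := by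
      by_cases hgt : 2 < (2 ^ k)⁻¹ * u x
      · rw [TT_deriv_gt hgt, abs_zero]; positivity
      · rw [not_lt, inv_mul_le_iff₀ hk] at hgt
        have h1 : (2:ℝ) ^ m ≤ 2 ^ (k + 1) := by rw [zpow_add_one₀ (by norm_num)]; linarith
        have h2 : m ≤ k + 1 := (zpow_le_zpow_iff_right₀ (by norm_num)).1 h1
        have h3 : (1:ℝ) ≤ 2 ^ (k - m) * 2 := by
          rw [← zpow_add_one₀ (by norm_num)]
          exact one_le_zpow₀ (by norm_num) (by omega)
        nlinarith [cL_bound ((2 ^ k)⁻¹ * u x)]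
    have b2 : 2 ^ k * TT ((2 ^ k)⁻¹ * u x) ≤ 2 ^ (k - m) * u x := by
      have : (2:ℝ) ^ k = 2 ^ (k - m) * 2 ^ m := by rw [← zpow_add₀ (by norm_num)]; congr 1; ring
      calc 2 ^ k * TT ((2 ^ k)⁻¹ * u x) ≤ 2 ^ k * 1 := by gcongr; exact TT_le_one _
        _ = 2 ^ (k - m) * 2 ^ m := by rw [mul_one, this]
        _ ≤ _ := by gcongr
    have hq : (0:ℝ) < 2 ^ (k - m) := by positivity
    have hu := h.nonneg x
    calc _ ≤ 2 ^ (k - m) * (2 * cL) * ‖tgrad M.nu u x‖ + 2 ^ (k - m) * u x * |meanCurv M x| := by gcongr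
      _ ≤ 2 ^ (k - m) * (2 * cL) * ‖tgrad M.nu u x‖ + 2 ^ (k - m) * u x * |meanCurv M x|
          + 2 ^ (k - m) * (‖tgrad M.nu u x‖ + 2 * cL * (|meanCurv M x| * u x)) := by
            apply le_add_of_nonneg_right; positivity
      _ = _ := by unfold hh; ring
  · have h1 : (2:ℝ) ^ (m + 1) ≤ 2 ^ k := zpow_le_zpow_right₀ (by norm_num) (by omega)
    have h2 : (2 ^ k)⁻¹ * u x < 1 := by rw [inv_mul_lt_iff₀ hk]; linarith
    rw [TT_deriv_lt h2, TT_zero h2.le]; simp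

theorem Adm.sum_trunc {M : Hypersurface n} {K : Set (Eu n)} {u : Eu n → ℝ} (h : Adm M K u) (x : Eu n) :
    ∑' k : ℤ, ENNReal.ofReal (2 ^ k) * ENNReal.ofReal (hh M (fun x => TT ((2 ^ k)⁻¹ * u x)) x) ≤
      ENNReal.ofReal (2 * (2 * cL + 1)) * ENNReal.ofReal (hh M u x) := by
  have hLp := cL_pos
  rcases (h.nonneg x).eq_or_lt with h0 | h0
  · have : ∀ k : ℤ, hh M (fun x => TT ((2 ^ k)⁻¹ * u x)) x = 0 := by
      intro k
      have ht := tgrad_comp (ν := M.nu) (φ := u) (f := fun t => TT ((2 ^ k)⁻¹ * t)) (f' := 0) (x := x)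
        (h.smooth.differentiable (by norm_num) x) (by
          have : (fun t => TT ((2 ^ k)⁻¹ * t)) =ᶠ[𝓝 (u x)] fun _ => 0 := by
            rw [← h0]
            have : Tendsto (fun t : ℝ => ((2:ℝ) ^ k)⁻¹ * t) (𝓝 0) (𝓝 0) := by
              have := (continuous_const_mul ((2:ℝ) ^ k)⁻¹).tendsto 0
              simpa using this
            filter_upwards [this (Iio_mem_nhds one_pos)] with t ht using TT_zero (le_of_lt ht)
          exact (hasDerivAt_const _ _).congr_of_eventuallyEq this)
      unfold hh
      rw [ht]
      simp only [← h0]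
      rw [TT_zero (by simp)]; simp
    simp [this]
  · obtain ⟨m, hm1, hm2⟩ := exists_mem_Ico_zpow h0 (by norm_num : (1:ℝ) < 2)
    calc _ ≤ ∑' k : ℤ, ENNReal.ofReal (if k ≤ m then (2:ℝ) ^ (k - m) else 0) * ENNReal.ofReal ((2 * cL + 1) * hh M u x) := by
          refine ENNReal.tsum_le_tsum fun k => ?_
          rw [← ENNReal.ofReal_mul (by positivity), ← ENNReal.ofReal_mul (by split_ifs <;> positivity)]
          exact ENNReal.ofReal_le_ofReal (h.hh_trunc x m k hm2 hm1)
      _ = _ := by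
          rw [ENNReal.tsum_mul_right, geo_sum, ENNReal.ofReal_mul (by positivity), ENNReal.ofReal_mul (by norm_num),
            ENNReal.ofReal_ofNat, mul_assoc]

def cs (n : ℕ) : ℝ := 4 ^ ((n : ℝ) / (n - 1)) * cw n * (2 * (2 * cL + 1)) ^ ((n : ℝ) / (n - 1))

theorem Adm.strong {M : Hypersurface n} {K : Set (Eu n)} {u : Eu n → ℝ} (h : Adm M K u) (hn : 2 ≤ n) :
    ∫⁻ x, ENNReal.ofReal (u x) ^ ((n : ℝ) / (n - 1)) ∂surfMeasure M ≤
      ENNReal.ofReal (cs n) * (∫⁻ x, ENNReal.ofReal (hh M u x) ∂surfMeasure M) ^ ((n : ℝ) / (n - 1)) := by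
  have hn' : (2 : ℝ) ≤ n := by exact_mod_cast hn
  have hLp := cL_pos
  have hp : 1 ≤ (n : ℝ) / (n - 1) := by rw [le_div_iff₀ (by linarith)]; linarith
  have hcw := cw_nonneg hn
  unfold cs
  set p := (n : ℝ) / (n - 1) with hpdef
  have hp0 : 0 ≤ p := by linarith
  set v : ℤ → Eu n → ℝ := fun k x => TT ((2 ^ k)⁻¹ * u x) with hv
  have hA : ∀ k, Adm M K (v k) := fun k => h.trunc (by positivity)
  have hms : ∀ k, MeasurableSet {x | 1 ≤ v k x} := fun k =>
    measurableSet_le measurable_const (hA k).smooth.continuous.measurable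
  have hpt : ∀ x, ENNReal.ofReal (u x) ^ p ≤
      ∑' k : ℤ, ({x | 1 ≤ v k x}).indicator (fun _ => ENNReal.ofReal (4 * 2 ^ k) ^ p) x := by
    intro x
    rcases (h.nonneg x).eq_or_lt with h0 | h0
    · rw [← h0, ENNReal.ofReal_zero, ENNReal.zero_rpow_of_pos (by linarith)]; exact zero_le
    · obtain ⟨m, hm1, hm2⟩ := exists_mem_Ico_zpow h0 (by norm_num : (1:ℝ) < 2)
      refine le_trans ?_ (ENNReal.le_tsum (m - 1))
      have e : (2:ℝ) ^ m = 2 ^ (m - 1) * 2 := by rw [← zpow_add_one₀ (by norm_num)]; congr 1; ring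
      have hk : (0:ℝ) < 2 ^ (m - 1) := by positivity
      have : x ∈ {x | 1 ≤ v (m - 1) x} := by
        show 1 ≤ TT _
        rw [TT_one]
        rw [le_inv_mul_iff₀ hk]; linarith
      rw [indicator_of_mem this]
      refine ENNReal.rpow_le_rpow (ENNReal.ofReal_le_ofReal ?_) hp0
      rw [zpow_add_one₀ (by norm_num)] at hm2
      linarith
  calc _ ≤ ∫⁻ x, ∑' k : ℤ, ({x | 1 ≤ v k x}).indicator (fun _ => ENNReal.ofReal (4 * 2 ^ k) ^ p) x ∂surfMeasure M :=
        lintegral_mono hpt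
    _ = ∑' k : ℤ, ENNReal.ofReal (4 * 2 ^ k) ^ p * surfMeasure M {x | 1 ≤ v k x} := by
        rw [lintegral_tsum (fun k => (measurable_const.indicator (hms k)).aemeasurable)]
        congr 1; ext k
        rw [lintegral_indicator_const (hms k)]
    _ ≤ ∑' k : ℤ, ENNReal.ofReal (4 * 2 ^ k) ^ p * (ENNReal.ofReal (cw n) *
          (∫⁻ x, ENNReal.ofReal (hh M (v k) x) ∂surfMeasure M) ^ p) := by
        refine ENNReal.tsum_le_tsum fun k => ?_
        gcongr
        exact (hA k).weak hn
    _ = ENNReal.ofReal 4 ^ p * ENNReal.ofReal (cw n) *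
          ∑' k : ℤ, (ENNReal.ofReal (2 ^ k) * ∫⁻ x, ENNReal.ofReal (hh M (v k) x) ∂surfMeasure M) ^ p := by
        rw [← ENNReal.tsum_mul_left]
        congr 1; ext k
        rw [ENNReal.mul_rpow_of_nonneg _ _ hp0, ENNReal.ofReal_mul (by norm_num), ENNReal.mul_rpow_of_nonneg _ _ hp0]
        ring
    _ ≤ ENNReal.ofReal 4 ^ p * ENNReal.ofReal (cw n) *
          (∑' k : ℤ, ENNReal.ofReal (2 ^ k) * ∫⁻ x, ENNReal.ofReal (hh M (v k) x) ∂surfMeasure M) ^ p := by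
        gcongr
        exact tsum_rpow_le _ hp
    _ = ENNReal.ofReal 4 ^ p * ENNReal.ofReal (cw n) *
          (∫⁻ x, ∑' k : ℤ, ENNReal.ofReal (2 ^ k) * ENNReal.ofReal (hh M (v k) x) ∂surfMeasure M) ^ p := by
        rw [lintegral_tsum (fun k => ((hA k).hh_cont.measurable.ennreal_ofReal.const_mul _).aemeasurable)]
        congr 3; ext k
        rw [lintegral_const_mul _ (hA k).hh_cont.measurable.ennreal_ofReal]
    _ ≤ ENNReal.ofReal 4 ^ p * ENNReal.ofReal (cw n) *
          (∫⁻ x, ENNReal.ofReal (2 * (2 * cL + 1)) * ENNReal.ofReal (hh M u x) ∂surfMeasure M) ^ p := by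
        gcongr with x
        exact h.sum_trunc x
    _ = _ := by
        rw [lintegral_const_mul _ h.hh_cont.measurable.ennreal_ofReal, ENNReal.mul_rpow_of_nonneg _ _ hp0,
          ENNReal.ofReal_rpow_of_nonneg (by positivity) hp0, ENNReal.ofReal_rpow_of_nonneg (by positivity) hp0,
          ENNReal.ofReal_mul (by positivity), ENNReal.ofReal_mul (by positivity)]
        ring

theorem hh_pow_le (M : Hypersurface n) {φ : Eu n → ℝ} (hφ : ContDiff ℝ 1 φ) {q : ℝ} (hq : 1 < q) (x : Eu n) :
    hh M (fun x => |φ x| ^ q) x ≤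
      (|φ x| ^ (2 * (q - 1))) ^ ((1:ℝ) / 2) * (2 * q ^ 2 * dd M φ x) ^ ((1:ℝ) / 2) := by
  have ht := tgrad_comp (ν := M.nu) (φ := φ) (x := x) (hφ.differentiable (by norm_num) x)
    (hasDerivAt_abs_rpow (φ x) hq)
  have hF := norm_nonneg (tgrad M.nu φ x)
  have e1 : hh M (fun x => |φ x| ^ q) x = |φ x| ^ (q - 1) * (q * ‖tgrad M.nu φ x‖ + |meanCurv M x * φ x|) := by
    unfold hh
    rw [ht, norm_smul, Real.norm_eq_abs, abs_mul, abs_mul, abs_of_pos (by linarith : 0 < q),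
      abs_of_nonneg (Real.rpow_nonneg (abs_nonneg (φ x)) (q - 2))]
    rcases eq_or_ne (φ x) 0 with h | h
    · simp [h, Real.zero_rpow (by linarith : q - 1 ≠ 0), Real.zero_rpow (by linarith : q ≠ 0)]
    · have hp : 0 < |φ x| := abs_pos.2 h
      have a1 : |φ x| ^ (q - 1) = |φ x| ^ (q - 2) * |φ x| := by
        rw [← Real.rpow_add_one hp.ne']; congr 1; ring
      have a2 : |φ x| ^ q = |φ x| ^ (q - 1) * |φ x| := by
        rw [← Real.rpow_add_one hp.ne']; congr 1; ring
      beta_reduce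
      rw [a2, a1, abs_mul]; ring
  rw [e1, ← Real.rpow_mul (abs_nonneg _), show 2 * (q - 1) * (1 / 2) = q - 1 by ring, ← Real.sqrt_eq_rpow]
  gcongr
  apply Real.le_sqrt_of_sq_le
  unfold dd
  rw [← sq_abs (meanCurv M x * φ x)]
  set a := ‖tgrad M.nu φ x‖
  have hb := abs_nonneg (meanCurv M x * φ x)
  set b := |meanCurv M x * φ x|
  have : b ^ 2 ≤ q ^ 2 * b ^ 2 := le_mul_of_one_le_left (by positivity) (by nlinarith)
  nlinarith [sq_nonneg (q * a - b)]

def c3 (n : ℕ) : ℝ := (cs n) ^ (2 * ((n : ℝ) - 1) / (n - 2)) * (2 * (2 * ((n : ℝ) - 1) / (n - 2)) ^ 2) ^ ((n : ℝ) / (n - 2))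

theorem cs_nonneg (hn : 2 ≤ n) : 0 ≤ cs n := by
  have := cw_nonneg hn
  have := cL_pos
  unfold cs; positivity

theorem sobolev (hn : 3 ≤ n) (M : Hypersurface n) {K : Set (Eu n)} (hK : IsCompact K)
    (hKM : K ⊆ M.carrier) {φ : Eu n → ℝ} (hφ : ContDiff ℝ 1 φ) (h0 : ∀ x ∈ M.carrier, x ∉ K → φ x = 0) :
    ∫⁻ x, ENNReal.ofReal (|φ x| ^ (2 * (n : ℝ) / (n - 2))) ∂surfMeasure M ≤
      ENNReal.ofReal (c3 n * (∫ x, dd M φ x ∂surfMeasure M) ^ ((n : ℝ) / (n - 2))) := by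
  have hn' : (3 : ℝ) ≤ n := by exact_mod_cast hn
  have hn1 : (0 : ℝ) < n - 1 := by linarith
  have hn2 : (0 : ℝ) < n - 2 := by linarith
  set q : ℝ := 2 * ((n : ℝ) - 1) / (n - 2) with hqd
  set s : ℝ := 2 * (n : ℝ) / (n - 2) with hsd
  set p : ℝ := (n : ℝ) / (n - 1) with hpd
  have hs : 0 < s := by positivity
  have hp : 0 < p := by positivity
  have hq : 1 < q := by rw [hqd, lt_div_iff₀ hn2]; linarith
  have hsq : 2 * (q - 1) = s := by rw [hqd, hsd]; field_simp; ring
  have hqp : q * p = s := by rw [hqd, hsd, hpd]; field_simp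
  have hcs := cs_nonneg (n := n) (by omega)
  have hu : Adm M K (fun x => |φ x| ^ q) := by
    refine ⟨hK, hKM, ?_, fun x => by positivity, fun x hx hxK => ?_⟩
    · simpa using hφ.norm_rpow hq
    · rw [h0 x hx hxK, abs_zero, Real.zero_rpow (by linarith)]
  have hst := hu.strong (by omega)
  have cB : Continuous (fun x => |φ x| ^ s) := hφ.continuous.abs.rpow_const fun x => Or.inr hs.le
  have iB : Integrable (fun x => |φ x| ^ s) (surfMeasure M) :=
    integrable_M M hK hKM cB fun x hx hxK => by rw [h0 x hx hxK, abs_zero, Real.zero_rpow hs.ne']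
  have iD := dd_integrable M hK hKM hφ h0
  have hD0 : 0 ≤ ∫ x, dd M φ x ∂surfMeasure M := integral_nonneg fun x => dd_nonneg M φ x
  have hB0 : 0 ≤ ∫ x, |φ x| ^ s ∂surfMeasure M := integral_nonneg fun x => by positivity
  have e1 : ∀ x, ENNReal.ofReal (|φ x| ^ q) ^ p = ENNReal.ofReal (|φ x| ^ s) := fun x => by
    rw [ENNReal.ofReal_rpow_of_nonneg (by positivity) hp.le, ← Real.rpow_mul (abs_nonneg _), hqp]
  simp only [← hpd, e1] at hst
  have hCS : ∫⁻ x, ENNReal.ofReal (hh M (fun x => |φ x| ^ q) x) ∂surfMeasure M ≤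
      (∫⁻ x, ENNReal.ofReal (|φ x| ^ s) ∂surfMeasure M) ^ ((1:ℝ)/2) *
      (∫⁻ x, ENNReal.ofReal (2 * q ^ 2 * dd M φ x) ∂surfMeasure M) ^ ((1:ℝ)/2) := by
    refine le_trans (lintegral_mono fun x => ?_) (ENNReal.lintegral_mul_norm_pow_le
      iB.aestronglyMeasurable.aemeasurable.ennreal_ofReal
      (iD.const_mul (2 * q ^ 2)).aestronglyMeasurable.aemeasurable.ennreal_ofReal (by norm_num) (by norm_num) (by norm_num))
    have := dd_nonneg M φ x
    rw [ENNReal.ofReal_rpow_of_nonneg (by positivity) (by norm_num),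
      ENNReal.ofReal_rpow_of_nonneg (by positivity) (by norm_num), ← ENNReal.ofReal_mul (by positivity)]
    apply ENNReal.ofReal_le_ofReal
    rw [← hsq]
    exact hh_pow_le M hφ hq x
  rw [← ofReal_integral_eq_lintegral_ofReal iB (Eventually.of_forall fun x => by positivity)] at hst hCS ⊢
  rw [← ofReal_integral_eq_lintegral_ofReal (iD.const_mul (2 * q ^ 2))
    (Eventually.of_forall fun x => mul_nonneg (by positivity) (dd_nonneg M φ x)), integral_const_mul] at hCS
  apply ENNReal.ofReal_le_ofReal
  set B := ∫ x, |φ x| ^ s ∂surfMeasure M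
  set D := ∫ x, dd M φ x ∂surfMeasure M
  have hX0 : 0 ≤ 2 * q ^ 2 * D := by positivity
  rw [ENNReal.ofReal_rpow_of_nonneg hB0 (by norm_num), ENNReal.ofReal_rpow_of_nonneg hX0 (by norm_num),
    ← ENNReal.ofReal_mul (by positivity)] at hCS
  have h1 := hst.trans (mul_le_mul_right (ENNReal.rpow_le_rpow hCS hp.le) _)
  rw [ENNReal.ofReal_rpow_of_nonneg (by positivity) hp.le, ← ENNReal.ofReal_mul hcs,
    ENNReal.ofReal_le_ofReal_iff (by positivity), ← Real.mul_rpow hB0 hX0, ← Real.rpow_mul (by positivity),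
    Real.mul_rpow hB0 hX0] at h1
  rcases hB0.eq_or_lt with hB | hB
  · rw [← hB]; unfold c3; positivity
  have hpp : 1 / 2 * p < 1 := by rw [hpd, mul_div, div_lt_one hn1]; linarith
  have h2 : B ^ (1 - 1 / 2 * p) ≤ cs n * (2 * q ^ 2 * D) ^ (1 / 2 * p) := by
    rw [Real.rpow_sub hB, Real.rpow_one, div_le_iff₀ (by positivity)]
    linarith
  have h3 := Real.rpow_le_rpow (by positivity) h2 (by positivity : 0 ≤ q)
  have ee : (1 - 1 / 2 * p) * q = 1 := by rw [sub_mul, one_mul, mul_assoc, mul_comm p, hqp, hqd, hsd]; field_simp; ring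
  have e2 : 1 / 2 * p * q = (n : ℝ) / (n - 2) := by rw [mul_assoc, mul_comm p, hqp, hsd]; field_simp
  rw [← Real.rpow_mul hB0, ee, Real.rpow_one, Real.mul_rpow hcs (by positivity), ← Real.rpow_mul hX0, e2,
    Real.mul_rpow (by positivity) hD0] at h3
  unfold c3
  linarith

theorem hs_real (hn : 3 ≤ n) (M : Hypersurface n) {K : Set (Eu n)} (hK : IsCompact K)
    (hKM : K ⊆ M.carrier) {φ : Eu n → ℝ} (hφ : ContDiff ℝ 1 φ) (h0 : ∀ x ∈ M.carrier, x ∉ K → φ x = 0)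
    {b : ℝ} (hb0 : 0 ≤ b) (hb1 : b ≤ 1) :
    (∫ x, |φ x| ^ (2 * ((n : ℝ) - 2 * b) / (n - 2)) / ‖x‖ ^ (2 * b) ∂surfMeasure M)
          ^ (((n : ℝ) - 2) / (n - 2 * b)) ≤ (8 * max 1 (c3 n)) * ∫ x, dd M φ x ∂surfMeasure M := by
  have hn' : (3 : ℝ) ≤ n := by exact_mod_cast hn
  have hn2 : (0 : ℝ) < n - 2 := by linarith
  have hnb : (0 : ℝ) < n - 2 * b := by linarith
  have hD0 : 0 ≤ ∫ x, dd M φ x ∂surfMeasure M := integral_nonneg fun x => dd_nonneg M φ x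
  have hA := hardy hn M hK hKM hφ h0
  have hB := sobolev hn M hK hKM hφ h0
  set D := ∫ x, dd M φ x ∂surfMeasure M
  set r : ℝ := 2 * ((n : ℝ) - 2 * b) / (n - 2) with hr
  set s : ℝ := 2 * (n : ℝ) / (n - 2) with hsd
  set m : ℝ := max 1 (c3 n)
  have hm1 : 1 ≤ m := le_max_left _ _
  have hr0 : 0 < r := by positivity
  have hs0 : 0 < s := by positivity
  have hrs : r = 2 * b + s * (1 - b) := by rw [hr, hsd]; field_simp; ring
  have cφ := hφ.continuous
  have hpt : ∀ x, |φ x| ^ r / ‖x‖ ^ (2 * b) ≤ (φ x ^ 2 / ‖x‖ ^ 2) ^ b * (|φ x| ^ s) ^ (1 - b) := by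
    intro x
    rcases eq_or_ne (φ x) 0 with h | h
    · rw [h, abs_zero, Real.zero_rpow hr0.ne', zero_div]; positivity
    · have hp : 0 < |φ x| := abs_pos.2 h
      rw [← sq_abs (φ x), Real.div_rpow (by positivity) (by positivity), ← Real.rpow_natCast, ← Real.rpow_natCast,
        ← Real.rpow_mul hp.le, ← Real.rpow_mul hp.le, ← Real.rpow_mul (norm_nonneg x), div_mul_eq_mul_div,
        ← Real.rpow_add hp, hrs]
      norm_num
  have hDn : 0 ≤ D ^ ((n : ℝ) / (n - 2)) := by positivity
  have hlin : ∫⁻ x, ENNReal.ofReal (|φ x| ^ r / ‖x‖ ^ (2 * b)) ∂surfMeasure M ≤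
      ENNReal.ofReal (8 * m * D ^ (((n : ℝ) - 2 * b) / (n - 2))) := by
    calc _ ≤ ∫⁻ x, ENNReal.ofReal (φ x ^ 2 / ‖x‖ ^ 2) ^ b * ENNReal.ofReal (|φ x| ^ s) ^ (1 - b) ∂surfMeasure M := by
          refine lintegral_mono fun x => ?_
          rw [ENNReal.ofReal_rpow_of_nonneg (by positivity) hb0,
            ENNReal.ofReal_rpow_of_nonneg (by positivity) (by linarith), ← ENNReal.ofReal_mul (by positivity)]
          exact ENNReal.ofReal_le_ofReal (hpt x)
      _ ≤ _ := ENNReal.lintegral_mul_norm_pow_le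
          (((cφ.pow 2).measurable.div (continuous_norm.pow 2).measurable).ennreal_ofReal.aemeasurable)
          ((cφ.abs.measurable.pow_const s).ennreal_ofReal.aemeasurable) hb0 (by linarith : 0 ≤ 1 - b) (by ring)
      _ ≤ ENNReal.ofReal (8 * D) ^ b * ENNReal.ofReal (m * D ^ ((n : ℝ) / (n - 2))) ^ (1 - b) := by
          refine mul_le_mul' (ENNReal.rpow_le_rpow hA hb0) (ENNReal.rpow_le_rpow (hB.trans ?_) (by linarith))
          apply ENNReal.ofReal_le_ofReal
          gcongr
          exact le_max_right _ _
      _ = ENNReal.ofReal ((8 * D) ^ b * (m * D ^ ((n : ℝ) / (n - 2))) ^ (1 - b)) := by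
          rw [ENNReal.ofReal_rpow_of_nonneg (by positivity) hb0,
            ENNReal.ofReal_rpow_of_nonneg (by positivity) (by linarith), ← ENNReal.ofReal_mul (by positivity)]
      _ ≤ _ := by
          apply ENNReal.ofReal_le_ofReal
          rw [Real.mul_rpow (by norm_num) hD0, Real.mul_rpow (by linarith) hDn, ← Real.rpow_mul hD0]
          have k1 : (8:ℝ) ^ b ≤ 8 := by
            conv_rhs => rw [← Real.rpow_one 8]
            exact Real.rpow_le_rpow_of_exponent_le (by norm_num) hb1
          have k2 : m ^ (1 - b) ≤ m := by
            conv_rhs => rw [← Real.rpow_one m]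
            exact Real.rpow_le_rpow_of_exponent_le hm1 (by linarith)
          have k3 : D ^ b * D ^ ((n : ℝ) / (n - 2) * (1 - b)) = D ^ (((n : ℝ) - 2 * b) / (n - 2)) := by
            rw [← Real.rpow_add_of_nonneg hD0 hb0 (mul_nonneg (by positivity) (by linarith))]
            congr 1; field_simp; ring
          calc _ = 8 ^ b * m ^ (1 - b) * (D ^ b * D ^ ((n : ℝ) / (n - 2) * (1 - b))) := by ring
            _ ≤ 8 * m * (D ^ b * D ^ ((n : ℝ) / (n - 2) * (1 - b))) := by gcongr
            _ = _ := by rw [k3]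
  have hreal : ∫ x, |φ x| ^ r / ‖x‖ ^ (2 * b) ∂surfMeasure M ≤ 8 * m * D ^ (((n : ℝ) - 2 * b) / (n - 2)) := by
    have hms : AEStronglyMeasurable (fun x => |φ x| ^ r / ‖x‖ ^ (2 * b)) (surfMeasure M) :=
      ((cφ.abs.measurable.pow_const r).div (continuous_norm.measurable.pow_const _)).aestronglyMeasurable
    rw [integral_eq_lintegral_of_nonneg_ae (Eventually.of_forall fun x => by positivity) hms]
    exact ENNReal.toReal_le_of_le_ofReal (by positivity) hlin
  have hex : 0 ≤ ((n : ℝ) - 2) / (n - 2 * b) := by positivity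
  refine (Real.rpow_le_rpow (integral_nonneg fun x => by positivity) hreal hex).trans ?_
  rw [Real.mul_rpow (by positivity) (by positivity), ← Real.rpow_mul hD0]
  have : ((n : ℝ) - 2 * b) / (n - 2) * ((n - 2) / (n - 2 * b)) = 1 := by field_simp
  rw [this, Real.rpow_one]
  gcongr
  conv_rhs => rw [← Real.rpow_one (8 * m)]
  apply Real.rpow_le_rpow_of_exponent_le (by linarith)
  rw [div_le_one hnb]; linarith

end Helpers

/-- Hardy–Sobolev inequality on hypersurfaces of `ℝ^{n+1}` with `n ≥ 3`, `b ∈ [0,1]`. -/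
theorem hardy_sobolev_two (n : ℕ) (hn : 3 ≤ n) :
    ∃ C : ℝ, 0 < C ∧ ∀ (M : Hypersurface n) (b : ℝ), 0 ≤ b → b ≤ 1 →
      ∀ φ : Eu n → ℝ, C1cOn M.carrier φ →
      (∫ x, |φ x| ^ (2 * ((n : ℝ) - 2 * b) / (n - 2)) / ‖x‖ ^ (2 * b) ∂surfMeasure M)
          ^ (((n : ℝ) - 2) / (n - 2 * b))
        ≤ C * ∫ x, ‖tgrad M.nu φ x‖ ^ 2 + (meanCurv M x * φ x) ^ 2 ∂surfMeasure M := by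
  refine ⟨8 * max 1 (c3 n), mul_pos (by norm_num) (lt_of_lt_of_le one_pos (le_max_left _ _)), ?_⟩
  rintro M b hb0 hb1 φ ⟨hφ, K, hK, hKM, h0⟩
  exact hs_real hn M hK hKM hφ h0 hb0 hb1
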